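/- arXiv:2102.03790 — 10 statements merged into one kernel-verified Lean document; each statement's English description precedes it below -/
import Mathlib

section
/- For a group G, the following are equivalent: (i) G admits a finitary selector (a macro-uniform map f from the nonempty finite subsets of G to G, with respect to the finitary coarse structure, such that f(A) ∈ A for every nonempty finite A ⊆ G); (ii) G admits a 2-selector (such a map defined only on 2-element subsets of G); (iii) either G contains an infinite cyclic subgroup of finite index, or G is countable and locally finite (every finite subset of G generates a finite subgroup). -/
open scoped Pointwise

/-- A finitary selector of a group `G`: a map from the nonempty finite subsets of `G` to `G`
(extended arbitrarily to all finite subsets) choosing a point of each nonempty finite set,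
which is macro-uniform with respect to the finitary coarse structure of `G`. -/
def IsFinitarySelector (G : Type*) [Group G] (f : Finset G → G) : Prop :=
  (∀ A : Finset G, A.Nonempty → f A ∈ A) ∧
  ∀ F : Finset G, (1 : G) ∈ F → ∃ F' : Finset G, (1 : G) ∈ F' ∧
    ∀ A B : Finset G, A.Nonempty → B.Nonempty →
      (A : Set G) ⊆ (F : Set G) * (B : Set G) → (B : Set G) ⊆ (F : Set G) * (A : Set G) →
      ∃ g ∈ F', f A = g * f B

/-- A 2-selector of a group `G`: a macro-uniform choice of a point of each 2-element subset. -/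
def IsTwoSelector (G : Type*) [Group G] (f : Finset G → G) : Prop :=
  (∀ A : Finset G, A.card = 2 → f A ∈ A) ∧
  ∀ F : Finset G, (1 : G) ∈ F → ∃ F' : Finset G, (1 : G) ∈ F' ∧
    ∀ A B : Finset G, A.card = 2 → B.card = 2 →
      (A : Set G) ⊆ (F : Set G) * (B : Set G) → (B : Set G) ⊆ (F : Set G) * (A : Set G) →
      ∃ g ∈ F', f A = g * f B

/-- A group is locally finite if every finite subset generates a finite subgroup. -/
def LocallyFiniteGroup (G : Type*) [Group G] : Prop :=
  ∀ S : Finset G, ((Subgroup.closure (S : Set G) : Subgroup G) : Set G).Finite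

/-- Data extracted from a two-selector. -/
def SelRel {G : Type*} [Group G] (r : G → G → Prop) : Prop :=
  (∀ x y, x ≠ y → (r x y ↔ ¬ r y x)) ∧
  ∀ T : Finset G, ∃ E : Finset G, (1 : G) ∈ E ∧ (∀ e ∈ E, e⁻¹ ∈ E) ∧
    ∀ t ∈ T, ∀ x y, x * y⁻¹ ∉ E → (r (t * x) y ↔ r x y) ∧ (r x (t * y) ↔ r x y)

theorem selRel_of_two {G : Type*} [Group G] {f : Finset G → G} (hf : IsTwoSelector G f) :
    ∃ r : G → G → Prop, SelRel r := by
  classical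
  obtain ⟨h1, h2⟩ := hf
  have hmem : ∀ x y, x ≠ y → f {x, y} = x ∨ f {x, y} = y := by
    intro x y hxy
    have := h1 {x, y} (Finset.card_pair hxy)
    simpa using this
  have hanti : ∀ x y, x ≠ y → (f {x, y} = x ↔ ¬ f {y, x} = y) := by
    intro x y hxy
    rw [Finset.pair_comm y x]
    rcases hmem x y hxy with h | h
    · simp [h, hxy]
    · simp [h, hxy.symm]
  refine ⟨fun x y => f {x, y} = x, hanti, ?_⟩
  intro T
  let F : Finset G := insert 1 (T ∪ T⁻¹)
  obtain ⟨F', hF'1, hF'⟩ := h2 F (by simp [F])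
  let E0 : Finset G := F ∪ F' ∪ F * F'⁻¹
  have hleft : ∀ t ∈ T, ∀ x y, x * y⁻¹ ∉ E0 → t * x ≠ y ∧ x ≠ y ∧
      (f {t * x, y} = t * x ↔ f {x, y} = x) := by
    intro t ht x y hxy
    have htF : t ∈ F := by simp [F, ht]
    have htF' : t⁻¹ ∈ F := by simp [F, ht]
    have h1F : (1 : G) ∈ F := by simp [F]
    have hne : x ≠ y := by
      rintro rfl
      apply hxy
      simp [E0, h1F]
    have hne' : t * x ≠ y := by
      rintro rfl
      apply hxy
      simp [E0, htF']
    refine ⟨hne', hne, ?_⟩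
    obtain ⟨g, hg, hgg⟩ := hF' {x, y} {t * x, y} (Finset.card_pair hne) (Finset.card_pair hne')
      (by
        intro z hz
        simp only [Finset.coe_insert, Finset.coe_singleton, Set.mem_insert_iff,
          Set.mem_singleton_iff] at hz
        rcases hz with rfl | rfl
        · exact Set.mem_mul.2 ⟨t⁻¹, by simpa using htF', t * z, by simp, by simp⟩
        · exact Set.mem_mul.2 ⟨1, by simpa using h1F, z, by simp, by simp⟩)
      (by
        intro z hz
        simp only [Finset.coe_insert, Finset.coe_singleton, Set.mem_insert_iff,
          Set.mem_singleton_iff] at hz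
        rcases hz with rfl | rfl
        · exact Set.mem_mul.2 ⟨t, by simpa using htF, x, by simp, by simp⟩
        · exact Set.mem_mul.2 ⟨1, by simpa using h1F, z, by simp, by simp⟩)
    rcases hmem x y hne with ha | ha <;> rcases hmem _ y hne' with hb | hb
    · simp [ha, hb]
    · exfalso
      rw [ha, hb] at hgg
      apply hxy
      simp [E0, hgg, hg]
    · exfalso
      rw [ha, hb] at hgg
      apply hxy
      have : x * y⁻¹ ∈ F * F'⁻¹ := by
        refine Finset.mem_mul.2 ⟨t⁻¹, htF', g⁻¹, by simpa using hg, ?_⟩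
        rw [hgg]; group
      simp only [E0, Finset.mem_union]
      exact Or.inr this
    · simp [ha, hb, hne.symm, hne'.symm]
  refine ⟨E0 ∪ E0⁻¹, ?_, ?_, ?_⟩
  · simp [E0, F]
  · intro e he
    simp only [Finset.mem_union, Finset.mem_inv'] at he ⊢
    rw [inv_inv]; exact he.symm
  · intro t ht x y hxy
    simp only [Finset.mem_union, Finset.mem_inv', not_or] at hxy
    refine ⟨(hleft t ht x y hxy.1).2.2, ?_⟩
    have h3 : y * x⁻¹ ∉ E0 := by
      have := hxy.2
      simpa using this
    obtain ⟨ha, hb, hc⟩ := hleft t ht y x h3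
    show f {x, t * y} = x ↔ f {x, y} = x
    rw [hanti x (t * y) ha.symm, hanti x y hb.symm, hc]

theorem SelRel.closed_false {G : Type*} [Group G] {r : G → G → Prop} (hr : SelRel r)
    (H : Subgroup G) (hH : (H : Set G).Infinite) (u : G)
    (hu : ∀ k ∈ H, ∀ y, (r (k * y) (u * y) ↔ r y (u * y))) : False := by
  classical
  obtain ⟨hanti, hmv⟩ := hr
  obtain ⟨E, hE1, hEs, hE⟩ := hmv {u}
  have hkey : ∀ k ∈ H, k ∉ E → ∀ y, (r y (u * y) ↔ ¬ r (k * y) (u * (k * y))) := by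
    intro k hk hkE y
    have hk1 : k * y ≠ y := by
      intro h
      apply hkE
      have : k = 1 := by simpa using h
      rw [this]; exact hE1
    have a1 := (hE u (by simp) (k * y) y (by simpa using hkE)).2
    have a2 := hu k hk y
    have hk' : y * (k * y)⁻¹ ∉ E := by
      intro h
      apply hkE
      have := hEs _ h
      simpa using this
    have a3 := (hE u (by simp) y (k * y) hk').2
    have a4 := hu k⁻¹ (H.inv_mem hk) (k * y)
    rw [inv_mul_cancel_left] at a4
    have a5 := hanti _ _ hk1
    tauto
  obtain ⟨h1, h1H, h1E⟩ := hH.exists_notMem_finset E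
  obtain ⟨h2, h2H, h2E⟩ := hH.exists_notMem_finset (E ∪ E.image (fun e => e * h1⁻¹))
  simp only [Finset.mem_union, Finset.mem_image, not_or, not_exists, not_and] at h2E
  have h21 : h2 * h1 ∉ E := fun h => h2E.2 _ h (by simp)
  have b1 := hkey h1 h1H h1E 1
  have b2 := hkey h2 h2H h2E.1 (h1 * 1)
  have b3 := hkey (h2 * h1) (H.mul_mem h2H h1H) h21 1
  rw [← mul_assoc h2 h1 1] at b2
  tauto

theorem SelRel.countable {G : Type*} [Group G] {r : G → G → Prop} (hr : SelRel r) :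
    Countable G := by
  classical
  by_cases hfin : Finite G
  · infer_instance
  have hinf : Infinite G := not_finite_iff_infinite.1 hfin
  choose E hE1 hEs hE using fun t : G => hr.2 {t}
  let e0 : ℕ ↪ G := Infinite.natEmbedding G
  obtain ⟨C, hC0, hC⟩ : ∃ C : ℕ → Subgroup G, C 0 = Subgroup.closure (Set.range e0) ∧
      ∀ n, C (n + 1) =
        Subgroup.closure ((C n : Set G) ∪ ⋃ t ∈ (C n : Set G), (E t : Set G)) :=
    ⟨fun n => Nat.rec (Subgroup.closure (Set.range e0))
      (fun _ K => Subgroup.closure ((K : Set G) ∪ ⋃ t ∈ (K : Set G), (E t : Set G))) n,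
      rfl, fun _ => rfl⟩
  have hcl : ∀ s : Set G, s.Countable → ((Subgroup.closure s : Subgroup G) : Set G).Countable := by
    intro s hs
    have := hs.to_subtype
    have hq : Countable (FreeGroup s) := Function.Surjective.countable
      (f := fun l : List (s × Bool) => FreeGroup.mk l) (fun x => ⟨x.toWord, FreeGroup.mk_toWord⟩)
    refine (Set.countable_range (FreeGroup.lift ((↑) : s → G))).mono ?_
    rw [← MonoidHom.coe_range, SetLike.coe_subset_coe, Subgroup.closure_le]
    intro x hx
    exact ⟨FreeGroup.of ⟨x, hx⟩, by simp⟩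
  have hcount : ∀ n, (C n : Set G).Countable := by
    intro n
    induction n with
    | zero => rw [hC0]; exact hcl _ (Set.countable_range _)
    | succ n ih =>
      rw [hC]
      exact hcl _ (ih.union (ih.biUnion fun t _ => (E t).countable_toSet))
  have hmono : Monotone C := by
    apply monotone_nat_of_le_succ
    intro n
    rw [hC]
    exact fun x hx => Subgroup.subset_closure (Or.inl hx)
  let H : Subgroup G := ⨆ n, C n
  have hmem : ∀ x, x ∈ H ↔ ∃ n, x ∈ C n := by
    intro x
    exact Subgroup.mem_iSup_of_directed (hmono.directed_le)
  have hHc : (H : Set G).Countable := by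
    have : (H : Set G) = ⋃ n, (C n : Set G) := by
      ext x
      simp [hmem]
    rw [this]
    exact Set.countable_iUnion hcount
  have hHi : (H : Set G).Infinite := by
    refine (Set.infinite_range_of_injective e0.injective).mono ?_
    intro x hx
    exact (hmem x).2 ⟨0, by rw [hC0]; exact Subgroup.subset_closure hx⟩
  have hHE : ∀ t ∈ H, ∀ e ∈ E t, e ∈ H := by
    intro t ht e he
    obtain ⟨n, hn⟩ := (hmem t).1 ht
    refine (hmem e).2 ⟨n + 1, ?_⟩
    rw [hC]
    apply Subgroup.subset_closure
    right
    simp only [Set.mem_iUnion]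
    exact ⟨t, hn, he⟩
  have hall : ∀ u, u ∈ H := by
    intro u
    by_contra hu
    apply hr.closed_false H hHi u
    intro k hk y
    refine (hE k k (by simp) y (u * y) ?_).1
    intro h
    apply hu
    have := hHE k hk _ h
    simpa using this
  have : (Set.univ : Set G).Countable := hHc.mono fun u _ => hall u
  exact Set.countable_univ_iff.1 this

theorem SelRel.cover {G : Type*} [Group G] {r : G → G → Prop} (hr : SelRel r)
    (S : Finset G) (hS : ((Subgroup.closure (S : Set G) : Subgroup G) : Set G).Infinite) :
    ∃ E : Finset G, ∀ u, ∃ e ∈ E, ∃ k ∈ Subgroup.closure (S : Set G), u = e * k := by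
  classical
  obtain ⟨E, hE1, hEs, hE⟩ := hr.2 (S ∪ S⁻¹)
  refine ⟨E, ?_⟩
  by_contra! hcon
  obtain ⟨u, hu⟩ := hcon
  apply hr.closed_false _ hS u
  intro k hk y
  have hstep : ∀ k ∈ Subgroup.closure (S : Set G), k * y * (u * y)⁻¹ ∉ E := by
    intro k hk h
    refine hu _ (hEs _ h) k hk ?_
    group
  induction hk using Subgroup.closure_induction_left with
  | one => simp
  | mul_left x hx z hz ih =>
    rw [mul_assoc, (hE x (by simp [Finset.mem_coe.1 hx]) (z * y) (u * y) (hstep z hz)).1]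
    exact ih
  | inv_mul_cancel x hx z hz ih =>
    rw [mul_assoc, (hE x⁻¹ (by simp [Finset.mem_coe.1 hx]) (z * y) (u * y) (hstep z hz)).1]
    exact ih

theorem SelRel.exists_infinite_order {G : Type*} [Group G] {r : G → G → Prop} (hr : SelRel r)
    [Infinite G] (S : Finset G) (hS : Subgroup.closure (S : Set G) = ⊤) :
    ∃ a : G, ¬ IsOfFinOrder a := by
  classical
  obtain ⟨E, hE1, hEs, hE⟩ := hr.2 (S ∪ S⁻¹)
  -- an invariant set is everything
  have hinv : ∀ Q : G → Prop, Q 1 → (∀ s ∈ S ∪ S⁻¹, ∀ z, Q z → Q (s * z)) → ∀ z, Q z := by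
    intro Q h1 hs z
    have hz : z ∈ Subgroup.closure (S : Set G) := by rw [hS]; trivial
    induction hz using Subgroup.closure_induction_left with
    | one => exact h1
    | mul_left x hx z hz ih => exact hs x (by simp [Finset.mem_coe.1 hx]) z ih
    | inv_mul_cancel x hx z hz ih => exact hs x⁻¹ (by simp [Finset.mem_coe.1 hx]) z ih
  have htype : ∀ y y', (∀ z ∈ (S ∪ S⁻¹) * E, (r (z * y) y ↔ r (z * y') y')) →
      ∀ z, z ∉ E → (r (z * y) y ↔ r (z * y') y') := by
    intro y y' h z
    have := hinv (fun z => z ∉ E → (r (z * y) y ↔ r (z * y') y')) (fun h => absurd hE1 h) ?_ z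
    · exact this
    · intro s hs z hz hsz
      by_cases hzE : z ∈ E
      · exact h _ (Finset.mul_mem_mul hs hzE)
      · have a1 := (hE s hs (z * y) y (by simpa using hzE)).1
        have a2 := (hE s hs (z * y') y' (by simpa using hzE)).1
        rw [mul_assoc, mul_assoc, a1, a2]
        exact hz hzE
  obtain ⟨c, hc⟩ := Finite.exists_infinite_fiber
    (fun y : G => fun z : ((S ∪ S⁻¹) * E : Finset G) => r ((z : G) * y) y)
  have hYinf : ((fun y : G => fun z : ((S ∪ S⁻¹) * E : Finset G) => r ((z : G) * y) y) ⁻¹'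
    {c}).Infinite := Set.infinite_coe_iff.1 hc
  obtain ⟨y, hy⟩ := hYinf.nonempty
  have hsame : ∀ y', y' ∈ ((fun y : G => fun z : ((S ∪ S⁻¹) * E : Finset G) =>
      r ((z : G) * y) y) ⁻¹' {c}) → ∀ z, z ∉ E → (r (z * y) y ↔ r (z * y') y') := by
    intro y' hy'
    apply htype
    intro z hz
    have e1 := congrFun hy ⟨z, hz⟩
    have e2 := congrFun hy' ⟨z, hz⟩
    simp only at e1 e2
    rw [e1, e2]
  let P : G → Prop := fun z => r (z * y) y
  -- infinitely many g with P g ↔ ¬ P g⁻¹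
  have hflip : ∀ D : Finset G, ∃ g, g ∉ D ∧ g⁻¹ ∉ D ∧ (P g ↔ ¬ P g⁻¹) := by
    intro D
    obtain ⟨y', hy', hy'D⟩ := hYinf.exists_notMem_finset ((D ∪ D⁻¹ ∪ E).image fun d => d * y)
    have hgD : y' * y⁻¹ ∉ D ∪ D⁻¹ ∪ E := by
      intro h
      exact hy'D (Finset.mem_image.2 ⟨_, h, by simp⟩)
    simp only [Finset.mem_union, Finset.mem_inv', not_or] at hgD
    refine ⟨y' * y⁻¹, hgD.1.1, hgD.1.2, ?_⟩
    have hE' : (y' * y⁻¹)⁻¹ ∉ E := by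
      intro h
      exact hgD.2 (by simpa using hEs _ h)
    have := hsame y' hy' _ hE'
    show r (y' * y⁻¹ * y) y ↔ ¬ r ((y' * y⁻¹)⁻¹ * y) y
    rw [this]
    have hne : y' ≠ y := by
      rintro rfl
      apply hgD.2
      simpa using hE1
    simpa using hr.1 _ _ hne
  -- choose p in P
  obtain ⟨p, hp⟩ : ∃ p, P p := by
    obtain ⟨g, -, -, hg⟩ := hflip ∅
    by_cases h : P g
    · exact ⟨_, h⟩
    · exact ⟨g⁻¹, by tauto⟩
  let B : Finset G := insert p E
  obtain ⟨D, hD1, hDs, hD⟩ := hr.2 B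
  have hBP : ∀ b ∈ B, ∀ z, z ∉ D → (P (b * z) ↔ P z) := by
    intro b hb z hz
    have := (hD b hb (z * y) y (by simpa using hz)).1
    rw [← mul_assoc] at this
    exact this
  obtain ⟨g, hgD, hgD', hPg, hPg'⟩ : ∃ g, g ∉ D ∧ g⁻¹ ∉ D ∧ P g ∧ ¬ P g⁻¹ := by
    obtain ⟨g, h1, h2, h3⟩ := hflip D
    by_cases h : P g
    · exact ⟨g, h1, h2, h, h3.1 h⟩
    · exact ⟨g⁻¹, h2, by simpa using h1, by tauto, by simpa using h⟩
  have hSP : ∀ s ∈ S ∪ S⁻¹, ∀ z, z ∉ E → (P (s * z) ↔ P z) := by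
    intro s hs z hz
    have := (hE s hs (z * y) y (by simpa using hz)).1
    rw [← mul_assoc] at this
    exact this
  -- P g ⊆ P
  have hsub : ∀ v, P (v * g⁻¹) → P v := by
    intro v hv
    by_contra hv'
    have hall : ∀ z, (¬ P (z * v) ∧ P (z * v * g⁻¹)) := by
      apply hinv
      · simpa using ⟨hv', hv⟩
      · rintro s hs z ⟨h1, h2⟩
        have n1 : z * v ∉ E := by
          intro h
          have := hBP (z * v) (Finset.mem_insert_of_mem h) g⁻¹ hgD'
          tauto
        have n2 : z * v * g⁻¹ ∉ E := by
          intro h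
          have := hBP _ (Finset.mem_insert_of_mem h) g hgD
          rw [inv_mul_cancel_right] at this
          tauto
        have a1 := hSP s hs _ n1
        have a2 := hSP s hs _ n2
        simp only [mul_assoc] at *
        tauto
    have := (hall (p * v⁻¹)).1
    simp at this
    exact this hp
  refine ⟨g, ?_⟩
  intro hfin
  obtain ⟨n, hn, hgn⟩ := isOfFinOrder_iff_pow_eq_one.1 hfin
  have hpow : ∀ m : ℕ, ¬ P (p * (g⁻¹) ^ (m + 1)) := by
    intro m
    induction m with
    | zero =>
      have := hBP p (Finset.mem_insert_self _ _) g⁻¹ hgD'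
      simp only [zero_add, pow_one]
      tauto
    | succ m ih =>
      intro h
      apply ih
      apply hsub
      rw [mul_assoc, ← pow_succ]
      exact h
  have := hpow (n - 1)
  rw [Nat.sub_add_cancel hn, inv_pow, hgn] at this
  simp at this
  exact this hp

theorem finiteIndex_of_cover {G : Type*} [Group G] (K : Subgroup G) (E : Finset G)
    (h : ∀ u, ∃ e ∈ E, ∃ k ∈ K, u = e * k) : K.FiniteIndex := by
  have : Finite (G ⧸ K) := by
    refine Finite.of_surjective (fun e : E => ((e : G) : G ⧸ K)) ?_
    intro q
    obtain ⟨u, rfl⟩ := QuotientGroup.mk_surjective q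
    obtain ⟨e, he, k, hk, rfl⟩ := h u
    refine ⟨⟨e, he⟩, ?_⟩
    simp [QuotientGroup.eq, hk]
  exact Subgroup.finiteIndex_of_finite_quotient

theorem two_imp_struct {G : Type*} [Group G] {f : Finset G → G} (hf : IsTwoSelector G f) :
    (∃ a : G, ¬ IsOfFinOrder a ∧ (Subgroup.zpowers a).FiniteIndex) ∨
        (Countable G ∧ LocallyFiniteGroup G) := by
  classical
  obtain ⟨r, hr⟩ := selRel_of_two hf
  by_cases hlf : LocallyFiniteGroup G
  · exact Or.inr ⟨hr.countable, hlf⟩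
  left
  unfold LocallyFiniteGroup at hlf
  push Not at hlf
  obtain ⟨S, hS⟩ := hlf
  have hS : ((Subgroup.closure (S : Set G) : Subgroup G) : Set G).Infinite := hS
  obtain ⟨E, hE⟩ := hr.cover S hS
  have : Infinite G := Set.infinite_univ_iff.1 (hS.mono (Set.subset_univ _))
  have htop : Subgroup.closure ((S ∪ E : Finset G) : Set G) = ⊤ := by
    rw [eq_top_iff]
    intro u _
    obtain ⟨e, he, k, hk, rfl⟩ := hE u
    refine Subgroup.mul_mem _ (Subgroup.subset_closure (by simp [he]))
      (Subgroup.closure_mono ?_ hk)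
    simp
  obtain ⟨a, ha⟩ := hr.exists_infinite_order (S ∪ E) htop
  refine ⟨a, ha, ?_⟩
  have hz : Subgroup.closure (({a} : Finset G) : Set G) = Subgroup.zpowers a := by
    rw [Finset.coe_singleton, Subgroup.zpowers_eq_closure]
  have hainf : ((Subgroup.zpowers a : Subgroup G) : Set G).Infinite := by
    intro h
    exact ha (finite_zpowers.1 h)
  obtain ⟨E', hE'⟩ := hr.cover {a} (by rw [hz]; exact hainf)
  rw [hz] at hE'
  exact finiteIndex_of_cover _ E' hE'

theorem fin_imp_two {G : Type*} [Group G] {f : Finset G → G} (hf : IsFinitarySelector G f) :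
    IsTwoSelector G f := by
  have hne : ∀ A : Finset G, A.card = 2 → A.Nonempty := fun A hA =>
    Finset.card_pos.1 (by omega)
  refine ⟨fun A hA => hf.1 A (hne A hA), fun F hF => ?_⟩
  obtain ⟨F', h1, h2⟩ := hf.2 F hF
  exact ⟨F', h1, fun A B hA hB => h2 A B (hne A hA) (hne B hB)⟩

theorem zpowers_imp_fin {G : Type*} [Group G] (a : G) (ha : ¬ IsOfFinOrder a)
    (hfi : (Subgroup.zpowers a).FiniteIndex) : ∃ f : Finset G → G, IsFinitarySelector G f := by
  classical
  have hfinq : Finite (G ⧸ Subgroup.zpowers a) := Subgroup.finite_quotient_of_finiteIndex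
  have := Fintype.ofFinite (G ⧸ Subgroup.zpowers a)
  have hinj : Function.Injective fun n : ℤ => a ^ n := injective_zpow_iff_not_isOfFinOrder.2 ha
  have hex : ∀ x : G, ∃ k : ℤ, x = (x : G ⧸ Subgroup.zpowers a).out * a ^ k := by
    intro x
    have : ((x : G ⧸ Subgroup.zpowers a).out : G ⧸ Subgroup.zpowers a) = x := by simp
    rw [QuotientGroup.eq] at this
    obtain ⟨k, hk⟩ := Subgroup.mem_zpowers_iff.1 this
    exact ⟨k, by rw [hk]; simp⟩
  choose h hh using hex
  have hmul : ∀ g x, h (g * x) = h (g * (x : G ⧸ Subgroup.zpowers a).out) + h x := by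
    intro g x
    obtain ⟨q, hq⟩ : ∃ q : G ⧸ Subgroup.zpowers a, q = x := ⟨_, rfl⟩
    have hx := hh x
    rw [← hq] at hx ⊢
    have e3 : g * x = g * q.out * a ^ h x := by
      rw [mul_assoc, ← hx]
    have e0 : ((g * x : G) : G ⧸ Subgroup.zpowers a) =
        ((g * q.out : G) : G ⧸ Subgroup.zpowers a) := by
      rw [QuotientGroup.eq, e3]
      refine Subgroup.mem_zpowers_iff.2 ⟨- h x, ?_⟩
      simp [mul_assoc]
    have e1 := hh (g * x)
    have e2 := hh (g * q.out)
    rw [e0] at e1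
    have e4 : ((g * q.out : G) : G ⧸ Subgroup.zpowers a).out * a ^ h (g * x) =
        ((g * q.out : G) : G ⧸ Subgroup.zpowers a).out * (a ^ (h (g * q.out) + h x)) := by
      rw [← e1, e3, zpow_add, ← mul_assoc, ← e2]
    exact hinj (mul_left_cancel e4)
  have hmin : ∀ A : Finset G, ∃ x, A.Nonempty → x ∈ A ∧ ∀ y ∈ A, h x ≤ h y := by
    intro A
    by_cases hA : A.Nonempty
    · obtain ⟨x, hx, hx'⟩ := A.exists_min_image h hA
      exact ⟨x, fun _ => ⟨hx, hx'⟩⟩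
    · exact ⟨1, fun h => absurd h hA⟩
  choose f hf using hmin
  refine ⟨f, fun A hA => (hf A hA).1, ?_⟩
  intro F hF
  obtain ⟨K, hK⟩ : ∃ K : ℤ, ∀ g ∈ F, ∀ q : G ⧸ Subgroup.zpowers a, - K ≤ h (g * q.out) := by
    obtain ⟨K, hK⟩ := ((F ×ˢ (Finset.univ : Finset (G ⧸ Subgroup.zpowers a))).image
      fun p => - h (p.1 * p.2.out)).bddAbove
    refine ⟨K, fun g hg q => ?_⟩
    have : - h (g * q.out) ≤ K := hK (by
      simp only [Finset.coe_image, Set.mem_image]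
      exact ⟨(g, q), by simp [hg], rfl⟩)
    omega
  let Q := G ⧸ Subgroup.zpowers a
  let F' : Finset G := insert 1 (((Finset.univ : Finset Q) ×ˢ (Finset.univ : Finset Q) ×ˢ
    Finset.Icc (-K) K).image fun p => p.1.out * a ^ p.2.2 * p.2.1.out⁻¹)
  refine ⟨F', by simp [F'], ?_⟩
  have hhalf : ∀ A B : Finset G, A.Nonempty → B.Nonempty →
      (A : Set G) ⊆ (F : Set G) * (B : Set G) → h (f B) ≤ h (f A) + K := by
    intro A B hA hB hAB
    obtain ⟨g, hg, b, hb, hgb⟩ := Set.mem_mul.1 (hAB (hf A hA).1)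
    have h1 := (hf B hB).2 b hb
    have h2 := hmul g b
    have h3 := hK g hg b
    rw [← hgb]
    omega
  intro A B hA hB hAB hBA
  have h1 := hhalf A B hA hB hAB
  have h2 := hhalf B A hB hA hBA
  refine ⟨f A * (f B)⁻¹, ?_, by simp⟩
  apply Finset.mem_insert_of_mem
  refine Finset.mem_image.2 ⟨((f A : Q), (f B : Q), h (f A) - h (f B)), ?_, ?_⟩
  · simp only [Finset.mem_product, Finset.mem_univ, true_and, Finset.mem_Icc]
    omega
  · conv_rhs => rw [hh (f A), hh (f B)]
    simp only [mul_inv_rev, zpow_sub, mul_assoc]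

theorem locfin_imp_fin {G : Type*} [Group G] [Countable G] (hlf : LocallyFiniteGroup G) :
    ∃ f : Finset G → G, IsFinitarySelector G f := by
  classical
  obtain ⟨e, he⟩ := exists_surjective_nat G
  let C : ℕ → Subgroup G := fun n =>
    Subgroup.closure (((Finset.range n).image e : Finset G) : Set G)
  have hmono : Monotone C := by
    intro m n hmn
    apply Subgroup.closure_mono
    intro x hx
    simp only [Finset.coe_image, Set.mem_image, Finset.coe_range, Set.mem_Iio] at hx ⊢
    obtain ⟨i, hi, rfl⟩ := hx
    exact ⟨i, by omega, rfl⟩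
  have hCfin : ∀ n, ((C n : Subgroup G) : Set G).Finite := fun n => hlf _
  have hin : ∀ x, ∃ n, x ∈ C n := by
    intro x
    obtain ⟨i, rfl⟩ := he x
    refine ⟨i + 1, Subgroup.subset_closure ?_⟩
    simp only [Finset.coe_image, Set.mem_image, Finset.coe_range, Set.mem_Iio]
    exact ⟨i, by omega, rfl⟩
  have hinF : ∀ F : Finset G, ∃ n, ∀ x ∈ F, x ∈ C n := by
    intro F
    choose N hN using hin
    refine ⟨F.sup N, fun x hx => hmono (Finset.le_sup hx) (hN x)⟩
  -- coset index
  let ι : ℕ → G → ℕ := fun n x => sInf {i : ℕ | e i * x⁻¹ ∈ C n}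
  have hιmem : ∀ n x, e (ι n x) * x⁻¹ ∈ C n := by
    intro n x
    obtain ⟨i, hi⟩ := he x
    exact Nat.sInf_mem (s := {i : ℕ | e i * x⁻¹ ∈ C n}) ⟨i, by simp [hi, (C n).one_mem]⟩
  have hι : ∀ n x y, ι n x = ι n y ↔ x * y⁻¹ ∈ C n := by
    intro n x y
    constructor
    · intro h
      have a1 := hιmem n x
      have a2 := hιmem n y
      rw [h] at a1
      have := (C n).mul_mem ((C n).inv_mem a1) a2
      simpa [mul_assoc] using this
    · intro h
      have : {i : ℕ | e i * x⁻¹ ∈ C n} = {i : ℕ | e i * y⁻¹ ∈ C n} := by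
        ext i
        constructor
        · intro hi
          have := (C n).mul_mem hi h
          simpa [mul_assoc] using this
        · intro hi
          have := (C n).mul_mem hi ((C n).inv_mem h)
          simpa [mul_assoc] using this
      simp only [ι, this]
  have hιmono : ∀ m n, m ≤ n → ∀ x y, ι m x = ι m y → ι n x = ι n y := by
    intro m n hmn x y h
    rw [hι] at h ⊢
    exact hmono hmn h
  have hιev : ∀ x y, ∃ n, ι n x = ι n y := by
    intro x y
    obtain ⟨n, hn⟩ := hin (x * y⁻¹)
    exact ⟨n, (hι n x y).2 hn⟩
  -- strict order
  let lt : G → G → Prop := fun x y => ∃ n, ι n x < ι n y ∧ ∀ m, n < m → ι m x = ι m y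
  have lt_trans' : ∀ x y z, lt x y → lt y z → lt x z := by
    rintro x y z ⟨n, h1, h2⟩ ⟨m, h3, h4⟩
    rcases lt_trichotomy n m with hnm | hnm | hnm
    · exact ⟨m, by rw [h2 m hnm]; exact h3, fun k hk => (h2 k (by omega)).trans (h4 k hk)⟩
    · subst hnm
      exact ⟨n, h1.trans h3, fun k hk => (h2 k hk).trans (h4 k hk)⟩
    · exact ⟨n, by rw [← h4 n hnm]; exact h1, fun k hk => (h2 k hk).trans (h4 k (by omega))⟩
  have lt_irrefl' : ∀ x, ¬ lt x x := by
    rintro x ⟨n, h, -⟩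
    exact lt_irrefl _ h
  have lt_total' : ∀ n x y, ι n x ≠ ι n y → lt x y ∨ lt y x := by
    intro n x y hne
    have hex := hιev x y
    let N := Nat.find hex
    have hN : ι N x = ι N y := Nat.find_spec hex
    have hNpos : N ≠ 0 := by
      intro h0
      apply hne
      exact hιmono N n (by omega) x y hN
    have hN' : ι (N - 1) x ≠ ι (N - 1) y := Nat.find_min hex (show N - 1 < N by omega)
    have hab : ∀ m, N - 1 < m → ι m x = ι m y := fun m hm => hιmono N m (by omega) x y hN
    rcases Nat.lt_or_gt_of_ne hN' with h | h
    · exact Or.inl ⟨N - 1, h, hab⟩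
    · exact Or.inr ⟨N - 1, h, fun m hm => (hab m hm).symm⟩
  have lt_convex : ∀ n x y x' y', lt x y → ι n x ≠ ι n y → ι n x = ι n x' → ι n y = ι n y' →
      lt x' y' := by
    rintro n x y x' y' ⟨m, h1, h2⟩ hne hx hy
    have hnm : n ≤ m := by
      by_contra hlt
      exact hne (h2 n (by omega))
    refine ⟨m, ?_, ?_⟩
    · rw [← hιmono n m hnm _ _ hx, ← hιmono n m hnm _ _ hy]
      exact h1
    · intro k hk
      rw [← hιmono n k (by omega) _ _ hx, ← hιmono n k (by omega) _ _ hy]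
      exact h2 k hk
  have hmin : ∀ A : Finset G, ∃ x, A.Nonempty → x ∈ A ∧ ∀ y ∈ A, ¬ lt y x := by
    intro A
    by_cases hA : A.Nonempty
    · have : IsTrans G lt := ⟨lt_trans'⟩
      have : Std.Irrefl lt := ⟨lt_irrefl'⟩
      have : IsStrictOrder G lt := {}
      have hwf : (A : Set G).WellFoundedOn lt := A.finite_toSet.wellFoundedOn
      obtain ⟨x, hx, hx'⟩ := hwf.has_min (Set.univ : Set (A : Set G))
        ⟨⟨hA.choose, hA.choose_spec⟩, trivial⟩
      exact ⟨x, fun _ => ⟨x.2, fun y hy => hx' ⟨y, hy⟩ trivial⟩⟩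
    · exact ⟨1, fun h => absurd h hA⟩
  choose f hf using hmin
  refine ⟨f, fun A hA => (hf A hA).1, ?_⟩
  intro F hF
  obtain ⟨n, hn⟩ := hinF F
  refine ⟨(hCfin n).toFinset, by simp [(C n).one_mem], ?_⟩
  have hhalf : ∀ A B : Finset G, A.Nonempty → B.Nonempty →
      (A : Set G) ⊆ (F : Set G) * (B : Set G) → ι n (f A) ≠ ι n (f B) → ¬ lt (f A) (f B) := by
    intro A B hA hB hAB hne hlt
    obtain ⟨g, hg, b, hb, hgb⟩ := Set.mem_mul.1 (hAB (hf A hA).1)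
    have hb' : ι n (f A) = ι n b := by
      rw [hι, ← hgb]
      simpa using hn g hg
    exact (hf B hB).2 b hb (lt_convex n _ _ _ _ hlt hne hb' rfl)
  intro A B hA hB hAB hBA
  refine ⟨f A * (f B)⁻¹, ?_, by simp⟩
  simp only [Set.Finite.mem_toFinset, SetLike.mem_coe]
  rw [← hι]
  by_contra hne
  rcases lt_total' n _ _ hne with h | h
  · exact hhalf A B hA hB hAB hne h
  · exact hhalf B A hB hA hBA (Ne.symm hne) h

theorem selector_characterization (G : Type*) [Group G] :
    ((∃ f : Finset G → G, IsFinitarySelector G f) ↔ (∃ f : Finset G → G, IsTwoSelector G f)) ∧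
    ((∃ f : Finset G → G, IsTwoSelector G f) ↔
      ((∃ a : G, ¬ IsOfFinOrder a ∧ (Subgroup.zpowers a).FiniteIndex) ∨
        (Countable G ∧ LocallyFiniteGroup G))) := by
  have h12 : (∃ f : Finset G → G, IsFinitarySelector G f) →
      (∃ f : Finset G → G, IsTwoSelector G f) := fun ⟨f, hf⟩ => ⟨f, fin_imp_two hf⟩
  have h23 : (∃ f : Finset G → G, IsTwoSelector G f) →
      ((∃ a : G, ¬ IsOfFinOrder a ∧ (Subgroup.zpowers a).FiniteIndex) ∨
        (Countable G ∧ LocallyFiniteGroup G)) := fun ⟨_, hf⟩ => two_imp_struct hf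
  have h31 : ((∃ a : G, ¬ IsOfFinOrder a ∧ (Subgroup.zpowers a).FiniteIndex) ∨
        (Countable G ∧ LocallyFiniteGroup G)) →
      (∃ f : Finset G → G, IsFinitarySelector G f) := by
    rintro (⟨a, ha, hfi⟩ | ⟨hc, hlf⟩)
    · exact zpowers_imp_fin a ha hfi
    · exact locfin_imp_fin hlf
  exact ⟨⟨h12, fun h => h31 (h23 h)⟩, ⟨h23, fun h => h12 (h31 h)⟩⟩
end

section
/- If a group G admits a 2-selector and contains an element a of infinite order, then the cyclic subgroup generated by a has finite index in G. -/
open scoped Pointwise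

lemma twoSel_key {G : Type*} [Group G] [DecidableEq G] (f : Finset G → G)
    (h1 : ∀ A : Finset G, A.card = 2 → f A ∈ A) (F F' : Finset G)
    (h2 : ∀ A B : Finset G, A.card = 2 → B.card = 2 →
      (A : Set G) ⊆ (F : Set G) * (B : Set G) → (B : Set G) ⊆ (F : Set G) * (A : Set G) →
      ∃ g ∈ F', f A = g * f B)
    (x y x' y' : G) (hxy : x ≠ y) (hxy' : x' ≠ y')
    (e1 : x * x'⁻¹ ∈ F) (e2 : y * y'⁻¹ ∈ F) (e3 : x' * x⁻¹ ∈ F) (e4 : y' * y⁻¹ ∈ F)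
    (n1 : x * y'⁻¹ ∉ F') (n2 : y * x'⁻¹ ∉ F') :
    f {x, y} = x ↔ f {x', y'} = x' := by
  have cA := Finset.card_pair hxy
  have cB := Finset.card_pair hxy'
  have mA := h1 _ cA
  have mB := h1 _ cB
  obtain ⟨g, hg, hgE⟩ := h2 _ _ cA cB
    (by
      intro z hz
      simp only [Finset.coe_insert, Finset.coe_singleton, Set.mem_insert_iff,
        Set.mem_singleton_iff] at hz
      rcases hz with rfl | rfl
      · exact Set.mem_mul.2 ⟨_, e1, x', by simp, by simp⟩
      · exact Set.mem_mul.2 ⟨_, e2, y', by simp, by simp⟩)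
    (by
      intro z hz
      simp only [Finset.coe_insert, Finset.coe_singleton, Set.mem_insert_iff,
        Set.mem_singleton_iff] at hz
      rcases hz with rfl | rfl
      · exact Set.mem_mul.2 ⟨_, e3, x, by simp, by simp⟩
      · exact Set.mem_mul.2 ⟨_, e4, y, by simp, by simp⟩)
  simp only [Finset.mem_insert, Finset.mem_singleton] at mA mB
  constructor
  · intro hx
    rcases mB with h | h
    · exact h
    · exact absurd (by rw [← hx, hgE, h]; simpa using hg) n1
  · intro hx
    rcases mA with h | h
    · exact h
    · exact absurd (by rw [← h, hgE, hx]; simpa using hg) n2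

/-- If a group admitting a 2-selector contains an element `a` of infinite order, then the
cyclic subgroup generated by `a` has finite index. -/
theorem zpowers_finiteIndex_of_twoSelector {G : Type*} [Group G]
    (f : Finset G → G) (hf : IsTwoSelector G f)
    (a : G) (ha : ¬ IsOfFinOrder a) :
    (Subgroup.zpowers a).FiniteIndex := by
  classical
  obtain ⟨h1, h2⟩ := hf
  have hinj : Function.Injective (fun n : ℤ => a ^ n) :=
    injective_zpow_iff_not_isOfFinOrder.2 ha
  obtain ⟨F', hF1, hF⟩ := h2 {1, a, a⁻¹} (by simp)
  have main : ∀ h : G, ∃ n : ℤ, a ^ n * h⁻¹ ∈ F' ∨ h * (a ^ n)⁻¹ ∈ F' := by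
    intro h
    by_contra hcon
    push Not at hcon
    obtain ⟨F₂, -, hF₂⟩ := h2 {1, h, h⁻¹} (by simp)
    have hne : ∀ n : ℤ, a ^ n ≠ h := by
      intro n hn
      apply (hcon n).1
      rw [hn]; simpa using hF1
    have ev : ∀ (T : Finset G) (φ : ℤ → G), Function.Injective φ →
        ∀ᶠ n in Filter.cofinite, φ n ∉ T := fun T φ hφ =>
      hφ.tendsto_cofinite.eventually T.finite_toSet.eventually_cofinite_notMem
    have i1 : Function.Injective (fun n : ℤ => a ^ (-n)) :=
      hinj.comp neg_injective
    obtain ⟨n, c0, c1, c2, c3, c4, c5, c6⟩ :=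
      ((ev {1} _ hinj).and ((ev F₂ _ hinj).and ((ev F₂ _ i1).and
        ((ev F₂ (fun n => a ^ n * h⁻¹) ((mul_left_injective _).comp hinj)).and
        ((ev F₂ (fun n => a ^ (-n) * h⁻¹) ((mul_left_injective _).comp i1)).and
        ((ev F' (fun n => a ^ (n - 1)) (hinj.comp (sub_left_injective))).and
        (ev F' (fun n => a ^ (-n - 1))
          (hinj.comp ((sub_left_injective (b := (1:ℤ))).comp neg_injective))))))))).exists
    simp only [Finset.mem_singleton] at c0
    have c0' : a ^ (-n) ≠ 1 := by simpa using c0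
    have e1 : ∀ k : ℤ, a ^ k * (a ^ (k + 1))⁻¹ = a⁻¹ := by
      intro k; rw [← zpow_neg, ← zpow_add, ← zpow_neg_one]; congr 1; ring
    have e2 : ∀ k : ℤ, a ^ (k + 1) * (a ^ k)⁻¹ = a := by
      intro k; rw [← zpow_neg, ← zpow_add]; conv_rhs => rw [← zpow_one a]
      congr 1; ring
    -- invariance along the line
    have s1 : ∀ k : ℤ, f {a ^ k, h} = a ^ k ↔ f {a ^ (k + 1), h} = a ^ (k + 1) := fun k =>
      twoSel_key f h1 _ F' hF _ _ _ _ (hne _) (hne _)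
        (by rw [e1]; simp) (by simp) (by rw [e2]; simp)
        (by simp) (hcon k).1 (hcon _).2
    have s1' : ∀ k : ℤ, f {a ^ k, h} = a ^ k ↔ f {a ^ (0 : ℤ), h} = a ^ (0 : ℤ) := by
      intro k
      induction k using Int.induction_on with
      | zero => rfl
      | succ i ih => rw [← s1, ih]
      | pred i ih => rw [s1, sub_add_cancel, ih]
    have hsh : ∀ k : ℤ, a ^ (n + k) ≠ a ^ k := by
      intro k hk
      apply c0
      rw [zpow_add] at hk
      simpa using hk
    have s2 : ∀ k : ℤ, f {a ^ (n + k), a ^ k} = a ^ (n + k) ↔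
        f {a ^ (n + (k + 1)), a ^ (k + 1)} = a ^ (n + (k + 1)) := fun k =>
      twoSel_key f h1 _ F' hF _ _ _ _ (hsh _) (hsh _)
        (by rw [← add_assoc, e1]; simp) (by rw [e1]; simp)
        (by rw [← add_assoc, e2]; simp) (by rw [e2]; simp)
        (by rw [← zpow_neg, ← zpow_add]; convert c5 using 3; ring)
        (by rw [← zpow_neg, ← zpow_add]; convert c6 using 3; ring)
    have s2' : ∀ k : ℤ, f {a ^ (n + k), a ^ k} = a ^ (n + k) ↔
        f {a ^ (n + 0), a ^ (0 : ℤ)} = a ^ (n + 0) := by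
      intro k
      induction k using Int.induction_on with
      | zero => rfl
      | succ i ih => rw [← s2, ih]
      | pred i ih => rw [s2, sub_add_cancel, ih]
    have t1 : f {a ^ n, 1} = a ^ n ↔ f {a ^ n, h} = a ^ n :=
      twoSel_key f h1 _ F₂ hF₂ _ _ _ _ c0 (hne _)
        (by simp) (by simp) (by simp) (by simp) c3 (by simpa using c2)
    have t2 : f {a ^ (-n), 1} = a ^ (-n) ↔ f {a ^ (-n), h} = a ^ (-n) :=
      twoSel_key f h1 _ F₂ hF₂ _ _ _ _ c0' (hne _)
        (by simp) (by simp) (by simp) (by simp) c4 (by simpa using c1)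
    have t3 := s2' (-n)
    rw [add_neg_cancel, add_zero, zpow_zero, Finset.pair_comm] at t3
    have t4 : f {a ^ (-n), 1} = a ^ (-n) ↔ f {a ^ n, 1} = a ^ n := by
      rw [t1, t2, s1', s1' n]
    have t5 := h1 _ (Finset.card_pair c0')
    simp only [Finset.mem_insert, Finset.mem_singleton] at t5
    rcases t5 with t5 | t5
    · exact c0' (t5.symm.trans (t3.2 (t4.1 t5)))
    · exact c0' ((t4.2 (t3.1 t5)).symm.trans t5)
  have : Finite (G ⧸ Subgroup.zpowers a) := by
    have hfin : ((fun g : G => (g : G ⧸ Subgroup.zpowers a)) '' ((F' ∪ F'⁻¹ : Finset G) : Set G)).Finite :=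
      (Finset.finite_toSet _).image _
    rw [← Set.finite_univ_iff]
    refine hfin.subset ?_
    rintro q -
    induction q using QuotientGroup.induction_on with
    | H h =>
      obtain ⟨n, hn | hn⟩ := main h
      · refine ⟨h * (a ^ n)⁻¹, ?_, ?_⟩
        · simp only [Finset.coe_union, Set.mem_union]
          right
          simpa using hn
        · refine QuotientGroup.eq.2 ⟨n, ?_⟩
          simp
      · refine ⟨h * (a ^ n)⁻¹, ?_, ?_⟩
        · simp only [Finset.coe_union, Set.mem_union]
          left
          simpa using hn
        · refine QuotientGroup.eq.2 ⟨n, ?_⟩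
          simp
  exact Subgroup.finiteIndex_of_finite_quotient
end

section
/- If a torsion group G (every element of G has finite order) admits a 2-selector, then G is locally finite, i.e. every finite subset of G generates a finite subgroup. -/
open scoped Pointwise

namespace TwoSel

variable {H : Type*} [Group H]

lemma inv_stable {g : H} (hg : IsOfFinOrder g) {U : Set H} (h : ∀ u ∈ U, u * g ∈ U) :
    ∀ u ∈ U, u * g⁻¹ ∈ U := by
  have hp : ∀ n : ℕ, ∀ u ∈ U, u * g ^ n ∈ U := by
    intro n
    induction n with
    | zero => intro u hu; simpa using hu
    | succ k ih =>
      intro u hu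
      rw [pow_succ, ← mul_assoc]
      exact h _ (ih u hu)
  obtain ⟨n, hn, h1⟩ := isOfFinOrder_iff_pow_eq_one.1 hg
  intro u hu
  have : g⁻¹ = g ^ (n - 1) := by
    rw [inv_eq_iff_mul_eq_one, ← pow_succ', Nat.sub_add_cancel hn, h1]
  rw [this]
  exact hp _ u hu

/-- `U` is a union of components of the complement of `B`. -/
def Clo (T B U : Set H) : Prop :=
  (∀ x ∈ U, x ∉ B) ∧ ∀ x ∈ U, ∀ t ∈ T, t * x ∉ B → t * x ∈ U

/-- `B` is connected and contains `1`. -/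
def Con (T B : Set H) : Prop :=
  1 ∈ B ∧ ∀ P : Set H, 1 ∈ P → (∀ x ∈ P, ∀ t ∈ T, t * x ∈ B → t * x ∈ P) → B ⊆ P

variable {T : Set H} (hsym : ∀ t ∈ T, t⁻¹ ∈ T) (hgen : Subgroup.closure T = ⊤)

include hsym hgen

lemma closed_all {P : Set H} (hP : ∀ x ∈ P, ∀ t ∈ T, t * x ∈ P) {x : H} (hx : x ∈ P) (y : H) :
    y ∈ P := by
  have key : ∀ g : H, ∀ z ∈ P, g * z ∈ P := by
    intro g
    have hg : g ∈ Subgroup.closure T := by rw [hgen]; trivial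
    induction hg using Subgroup.closure_induction'' with
    | mem t ht => intro z hz; exact hP z hz t ht
    | inv_mem t ht => intro z hz; exact hP z hz _ (hsym t ht)
    | one => intro z hz; simpa using hz
    | mul a b _ _ iha ihb => intro z hz; rw [mul_assoc]; exact iha _ (ihb _ hz)
  simpa using key (y * x⁻¹) x hx

lemma exists_con_one (h : H) : ∃ B : Set H, B.Finite ∧ Con T B ∧ h ∈ B := by
  refine closed_all hsym hgen (P := {h | ∃ B : Set H, B.Finite ∧ Con T B ∧ h ∈ B}) ?_ (x := 1) ?_ h
  · rintro x ⟨B, hB, ⟨h1, hc⟩, hx⟩ t ht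
    refine ⟨insert (t * x) B, hB.insert _, ⟨Or.inr h1, ?_⟩, Or.inl rfl⟩
    intro P hP1 hP
    have hBP : B ⊆ P := hc P hP1 (fun x hx t ht h => hP x hx t ht (Or.inr h))
    rintro y (rfl | hy)
    · exact hP x (hBP hx) t ht (Or.inl rfl)
    · exact hBP hy
  · refine ⟨{1}, Set.finite_singleton _, ⟨rfl, ?_⟩, rfl⟩
    rintro P hP - y rfl
    exact hP

lemma exists_con {K : Set H} (hK : K.Finite) : ∃ B : Set H, B.Finite ∧ Con T B ∧ K ⊆ B := by
  choose B hB hc hm using exists_con_one (T := T) hsym hgen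
  refine ⟨B 1 ∪ ⋃ k ∈ K, B k, (hB 1).union (hK.biUnion fun k _ => hB k), ⟨Or.inl (hc 1).1, ?_⟩, ?_⟩
  · intro P hP1 hP
    apply Set.union_subset
    · exact (hc 1).2 P hP1 fun x hx t ht h => hP x hx t ht (Or.inl h)
    · refine Set.iUnion₂_subset fun k hk => ?_
      exact (hc k).2 P hP1 fun x hx t ht h =>
        hP x hx t ht (Or.inr (Set.mem_biUnion hk h))
  · intro k hk
    exact Or.inr (Set.mem_biUnion hk (hm k))

/-- the complement of a clopen `U` is connected -/
lemma compl_conn_aux {B U : Set H} (hB : Con T B) (hU : Clo T B U) {P : Set H}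
    (hPU : ∀ x ∈ P, x ∉ U) (hP : ∀ x ∈ P, ∀ t ∈ T, t * x ∉ U → t * x ∈ P)
    (h1 : 1 ∉ P) : P = ∅ := by
  have hBP : B ⊆ Pᶜ := by
    have : B ⊆ {x | x ∈ B ∧ x ∉ P} := by
      refine hB.2 _ ⟨hB.1, h1⟩ ?_
      rintro x ⟨hxB, hx⟩ t ht htx
      refine ⟨htx, fun hmem => hx ?_⟩
      have := hP _ hmem _ (hsym t ht) (by simpa using fun h => hU.1 x h hxB)
      simpa using this
    exact fun x hx => (this hx).2
  by_contra hne
  obtain ⟨x, hx⟩ := Set.nonempty_iff_ne_empty.2 hne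
  refine h1 (closed_all hsym hgen (P := P) ?_ hx 1)
  intro z hz t ht
  apply hP z hz t ht
  intro hU'
  apply hPU z hz
  have := hU.2 _ hU' _ (hsym t ht) (by simpa using fun h => hBP h hz)
  simpa using this


lemma compl_conn {B U : Set H} (hB : Con T B) (hU : Clo T B U) {Q : Set H}
    (hQ : ∀ x ∈ Q, ∀ t ∈ T, x ∉ U → t * x ∉ U → t * x ∈ Q) :
    (∀ x, x ∉ U → x ∈ Q) ∨ (∀ x, x ∉ U → x ∉ Q) := by
  by_cases h1 : 1 ∈ Q
  · left
    have := compl_conn_aux hsym hgen hB hU (P := {x | x ∉ U ∧ x ∉ Q}) (fun x hx => hx.1)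
      (by
        rintro x ⟨hxU, hxQ⟩ t ht htx
        refine ⟨htx, fun h => hxQ ?_⟩
        simpa using hQ _ h _ (hsym t ht) htx (by simpa using hxU)) (fun h => h.2 h1)
    intro x hx
    by_contra hxQ
    have h : x ∈ {x | x ∉ U ∧ x ∉ Q} := ⟨hx, hxQ⟩
    rw [this] at h
    exact h
  · right
    have := compl_conn_aux hsym hgen hB hU (P := {x | x ∉ U ∧ x ∈ Q}) (fun x hx => hx.1)
      (by
        rintro x ⟨hxU, hxQ⟩ t ht htx
        exact ⟨htx, hQ x hxQ t ht hxU htx⟩) (fun h => h1 h.2)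
    intro x hx hxQ
    have h : x ∈ {x | x ∉ U ∧ x ∈ Q} := ⟨hx, hxQ⟩
    rw [this] at h
    exact h

lemma exists_flip (htor : ∀ g : H, IsOfFinOrder g) {B U : Set H} (hBf : B.Finite)
    (hB : Con T B) (hU : Clo T B U) (hinf : U.Infinite) : ∃ g : H, ∀ x, x ∉ U → x * g ∈ U := by
  obtain ⟨g, hgU, hg⟩ := hinf.exists_notMem_finite (hBf.inv.mul hBf)
  have hdis : ∀ b ∈ B, b * g ∉ B := fun b hb h =>
    hg ⟨b⁻¹, Set.inv_mem_inv.2 hb, b * g, h, by simp⟩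
  have hBg : ∀ b ∈ B, b * g ∈ U := by
    have : B ⊆ {b | b ∈ B ∧ b * g ∈ U} := by
      refine hB.2 _ ⟨hB.1, by simpa using hgU⟩ ?_
      rintro x ⟨hxB, hx⟩ t ht htx
      refine ⟨htx, ?_⟩
      rw [mul_assoc]
      apply hU.2 _ hx t ht
      rw [← mul_assoc]
      exact hdis _ htx
    exact fun b hb => (this hb).2
  have hcases := compl_conn hsym hgen hB hU (Q := {x | x * g⁻¹ ∈ U}) (by
    intro x hx t ht hxU htx
    change t * x * g⁻¹ ∈ U
    rw [mul_assoc]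
    apply hU.2 _ hx t ht
    intro h
    apply htx
    simpa [mul_assoc] using hBg _ h)
  rcases hcases with h | h
  · refine ⟨g⁻¹, h⟩
  · exfalso
    have hst : ∀ u ∈ U, u * g ∈ U := by
      intro u hu
      by_contra hn
      exact h _ hn (by simpa using hu)
    have := inv_stable (htor g) hst g hgU
    rw [mul_inv_cancel] at this
    exact hU.1 _ this hB.1

lemma one_end (htor : ∀ g : H, IsOfFinOrder g) {B U V : Set H} (hBf : B.Finite)
    (hB : Con T B) (hU : Clo T B U) (hV : Clo T B V) (hUV : ∀ x ∈ U, x ∉ V)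
    (hUi : U.Infinite) : V.Finite := by
  by_contra hVi
  obtain ⟨g, hg⟩ := exists_flip hsym hgen htor hBf hB hU hUi
  obtain ⟨h, hh⟩ := exists_flip hsym hgen htor hBf hB hV hVi
  have key : ∀ x, x ∉ U → x * (g * h) ∈ V := by
    intro x hx
    rw [← mul_assoc]
    exact hh _ (hUV _ (hg x hx))
  have hst := inv_stable (htor (g * h)) (U := Uᶜ) (fun x hx h' => hUV _ h' (key x hx))
  have h1 : (1 : H) ∈ Uᶜ := fun h => hU.1 _ h hB.1
  have h2 := key _ (hst 1 h1)
  rw [one_mul, inv_mul_cancel] at h2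
  exact hV.1 _ h2 hB.1

lemma clo_ext {B U V : Set H} (h1B : 1 ∈ B)
    (hU : Clo T B U) (hV : Clo T B V) (h : ∀ t ∈ T, ∀ b ∈ B, t * b ∈ U → t * b ∈ V) : U ⊆ V := by
  intro x hx
  by_contra hxV
  have := closed_all hsym hgen (P := {x | x ∈ U ∧ x ∉ V}) (x := x) (by
    rintro z ⟨hzU, hzV⟩ t ht
    have hnB : t * z ∉ B := by
      intro hb
      apply hzV
      have := h _ (hsym t ht) _ hb (by simpa using hzU)
      simpa using this
    refine ⟨hU.2 z hzU t ht hnB, fun hv => hzV ?_⟩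
    have := hV.2 _ hv _ (hsym t ht) (by simpa using hU.1 z hzU)
    simpa using this) ⟨hx, hxV⟩ 1
  exact hU.1 _ this.1 h1B

lemma finite_clo (hT : T.Finite) {B : Set H} (hBf : B.Finite) (h1B : 1 ∈ B) :
    {U : Set H | Clo T B U}.Finite := by
  have hfin : (𝒫 (T * B)).Finite := (hT.mul hBf).finite_subsets
  refine Set.Finite.of_injOn (f := fun U => U ∩ (T * B)) (t := 𝒫 (T * B))
    (fun U _ => Set.inter_subset_right) ?_ hfin
  intro U hU V hV hUV
  have hUV' : U ∩ (T * B) = V ∩ (T * B) := hUV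
  apply Set.Subset.antisymm
  · refine clo_ext hsym hgen h1B hU hV fun t ht b hb h => ?_
    have : t * b ∈ U ∩ (T * B) := ⟨h, Set.mul_mem_mul ht hb⟩
    rw [hUV'] at this
    exact this.1
  · refine clo_ext hsym hgen h1B hV hU fun t ht b hb h => ?_
    have : t * b ∈ V ∩ (T * B) := ⟨h, Set.mul_mem_mul ht hb⟩
    rw [← hUV'] at this
    exact this.1

lemma main (htor : ∀ g : H, IsOfFinOrder g) (hT : T.Finite) (o : H → H → Prop)
    (hanti : ∀ x y, x ≠ y → (o x y ↔ ¬ o y x)) {K : Set H} (hK : K.Finite)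
    (ho : ∀ x y, ∀ t ∈ T, y * x⁻¹ ∉ K → t * y * x⁻¹ ∉ K → o x y → o x (t * y)) : Finite H := by
  by_contra hinf
  rw [not_finite_iff_infinite] at hinf
  obtain ⟨B, hBf, hB, hKB⟩ := exists_con (T := T) hsym hgen hK
  set M : Set H := ⋃ U ∈ {U : Set H | Clo T B U ∧ U.Finite}, U with hM
  have hMf : M.Finite :=
    Set.Finite.biUnion ((finite_clo hsym hgen hT hBf hB.1).subset fun U h => h.1)
      fun U hU => hU.2
  have hMm : ∀ U, Clo T B U → U.Finite → ∀ x ∈ U, x ∈ M := fun U h1 h2 x hx =>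
    Set.mem_biUnion (show U ∈ {U : Set H | Clo T B U ∧ U.Finite} from ⟨h1, h2⟩) hx
  have hne : ∀ x y : H, y * x⁻¹ ∉ B → x ≠ y := by
    rintro x y h rfl
    apply h
    simpa using hB.1
  let U : H → Set H := fun x => {h | h ∉ B ∧ o x (h * x)}
  let V : H → Set H := fun x => {h | h ∉ B ∧ ¬ o x (h * x)}
  have hU : ∀ x, Clo T B (U x) := by
    refine fun x => ⟨fun h hh => hh.1, ?_⟩
    rintro h ⟨hh, hoh⟩ t ht hth
    refine ⟨hth, ?_⟩
    rw [mul_assoc]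
    exact ho _ _ t ht (by simpa using fun h' => hh (hKB h'))
      (by simpa [mul_assoc] using fun h' => hth (hKB h')) hoh
  have hV : ∀ x, Clo T B (V x) := by
    refine fun x => ⟨fun h hh => hh.1, ?_⟩
    rintro h ⟨hh, hoh⟩ t ht hth
    refine ⟨hth, fun hc => hoh ?_⟩
    have := ho _ _ _ (hsym t ht) (by simpa using fun h' => hth (hKB h'))
      (by simpa [mul_assoc] using fun h' => hh (hKB h')) hc
    simpa [mul_assoc] using this
  have hs : ∀ x y, y * x⁻¹ ∉ B → y * x⁻¹ ∉ M → (o x y ↔ (U x).Infinite) := by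
    intro x y hyB hyM
    constructor
    · intro h hfin
      exact hyM (hMm _ (hU x) hfin _ ⟨hyB, by simpa using h⟩)
    · intro hi
      have hVf := one_end hsym hgen htor hBf hB (hU x) (hV x) (fun h h1 h2 => h2.2 h1.2) hi
      by_contra h
      exact hyM (hMm _ (hV x) hVf _ ⟨hyB, by simpa using h⟩)
  set N : Set H := (B ∪ M) ∪ (B ∪ M)⁻¹ with hN
  have hNf : N.Finite := (hBf.union hMf).union (hBf.union hMf).inv
  have hpair : ∀ x y, y * x⁻¹ ∉ N → ((U x).Infinite ↔ ¬ (U y).Infinite) := by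
    intro x y h
    have h1 : y * x⁻¹ ∉ B := fun h' => h (Or.inl (Or.inl h'))
    have h2 : y * x⁻¹ ∉ M := fun h' => h (Or.inl (Or.inr h'))
    have h3 : x * y⁻¹ ∉ B := fun h' => h (Or.inr (Or.inl (by simpa using h')))
    have h4 : x * y⁻¹ ∉ M := fun h' => h (Or.inr (Or.inr (by simpa using h')))
    rw [← hs x y h1 h2, ← hs y x h3 h4]
    exact hanti x y (hne x y h1)
  obtain ⟨y, -, hy⟩ := (Set.infinite_univ (α := H)).exists_notMem_finite hNf
  obtain ⟨z, -, hz⟩ := (Set.infinite_univ (α := H)).exists_notMem_finite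
    (hNf.union (hNf.mul (Set.finite_singleton y)))
  have a := hpair 1 y (by simpa using hy)
  have b := hpair 1 z (by simpa using fun h => hz (Or.inl h))
  have c := hpair y z (fun h => hz (Or.inr ⟨z * y⁻¹, h, y, rfl, by simp⟩))
  tauto

end TwoSel


/-- A torsion group admitting a 2-selector is locally finite: every finite subset
generates a finite subgroup. -/
theorem locallyFinite_of_torsion_twoSelector {G : Type*} [Group G]
    (htor : ∀ g : G, IsOfFinOrder g)
    (f : Finset G → G) (hf : IsTwoSelector G f) :
    ∀ S : Finset G, ((Subgroup.closure (S : Set G) : Subgroup G) : Set G).Finite := by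
  classical
  intro S
  let H := Subgroup.closure (S : Set G)
  let T : Set H := {h | (h : G) ∈ S ∨ (h : G)⁻¹ ∈ S}
  have hTf : T.Finite := by
    have h1 : ((S : Set G) ∪ (S : Set G)⁻¹).Finite :=
      S.finite_toSet.union S.finite_toSet.inv
    exact (h1.preimage (f := ((↑) : H → G)) Subtype.val_injective.injOn).subset
      (fun h hh => by simpa [T] using hh)
  have hsym : ∀ t ∈ T, t⁻¹ ∈ T := by
    intro t ht
    rcases ht with h | h
    · right; simpa using h
    · left; simpa using h
  have hgen : Subgroup.closure T = ⊤ := by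
    rw [eq_top_iff, ← Subgroup.closure_closure_coe_preimage (k := (S : Set G))]
    apply Subgroup.closure_mono
    intro h hh
    exact Or.inl hh
  let F : Finset G := insert 1 (S ∪ S⁻¹)
  obtain ⟨F', h1F', hF'⟩ := hf.2 F (by simp [F])
  let KG : Set G := insert 1 ((F' : Set G) ∪ ((F' : Set G))⁻¹)
  have hKG : KG.Finite := (F'.finite_toSet.union F'.finite_toSet.inv).insert 1
  have hK : (((↑) : H → G) ⁻¹' KG).Finite := hKG.preimage Subtype.val_injective.injOn
  have hfin : Finite H := by
    refine TwoSel.main hsym hgen (fun g => ?_) hTf (fun x y => f {(x : G), (y : G)} = x)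
      ?_ hK ?_
    · exact Submonoid.isOfFinOrder_coe.1 (htor g)
    · intro x y hxy
      have hxy' : (x : G) ≠ y := fun h => hxy (Subtype.ext h)
      have := hf.1 {(x : G), (y : G)} (Finset.card_pair hxy')
      rw [Finset.pair_comm (y : G) x]
      simp only [Finset.mem_insert, Finset.mem_singleton] at this
      constructor
      · intro h h'
        exact hxy' (h.symm.trans h')
      · intro h
        exact this.resolve_right h
    · intro x y t ht h1 h2 hxy
      have hxy1 : (x : G) ≠ y := by
        intro h
        apply h1
        left
        simp [h]
      have hxy2 : (x : G) ≠ t * y := by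
        intro h
        apply h2
        left
        simp [h]
      have htF : (t : G) ∈ F ∧ (t : G)⁻¹ ∈ F := by
        rcases ht with h | h <;> simp [F, h]
      obtain ⟨g, hg, hgf⟩ := hF' {(x : G), (y : G)} {(x : G), (t * y : G)}
        (Finset.card_pair hxy1) (Finset.card_pair hxy2)
        (by
          intro z hz
          simp only [Finset.coe_insert, Finset.coe_singleton, Set.mem_insert_iff,
            Set.mem_singleton_iff] at hz
          rcases hz with rfl | rfl
          · exact ⟨1, by simp [F], x, by simp, by simp⟩
          · exact ⟨_, htF.2, t * y, by simp, by simp⟩)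
        (by
          intro z hz
          simp only [Finset.coe_insert, Finset.coe_singleton, Set.mem_insert_iff,
            Set.mem_singleton_iff] at hz
          rcases hz with rfl | rfl
          · exact ⟨1, by simp [F], x, by simp, by simp⟩
          · exact ⟨_, htF.1, y, by simp, by simp⟩)
      have hm := hf.1 {(x : G), (t * y : G)} (Finset.card_pair hxy2)
      simp only [Finset.mem_insert, Finset.mem_singleton] at hm
      rcases hm with h | h
      · exact h
      · exfalso
        apply h2
        right; right
        rw [hxy, h] at hgf
        have : ((t * y * x⁻¹ : H) : G)⁻¹ = g := by
          rw [eq_comm, eq_mul_inv_of_mul_eq hgf.symm]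
          push_cast
          group
        rw [Set.mem_inv, this]
        exact hg
  exact Set.toFinite _
end

section
/- Every countable locally finite group G admits a global selector: there is a map f from the nonempty subsets of G to G with f(A) ∈ A for every nonempty A ⊆ G, which is macro-uniform with respect to the finitary coarse structure. (In fact, G carries a well-order for which f(A) = min A is such a selector.) -/
open scoped Pointwise

/-- A global selector of a group `G`: a map from the nonempty subsets of `G` to `G`
choosing a point of each nonempty set, which is macro-uniform with respect to the
finitary coarse structure of `G`. -/
def IsGlobalSelector (G : Type*) [Group G] (f : Set G → G) : Prop :=
  (∀ A : Set G, A.Nonempty → f A ∈ A) ∧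
  ∀ F : Finset G, (1 : G) ∈ F → ∃ F' : Finset G, (1 : G) ∈ F' ∧
    ∀ A B : Set G, A.Nonempty → B.Nonempty →
      A ⊆ (F : Set G) * B → B ⊆ (F : Set G) * A →
      ∃ g ∈ F', f A = g * f B

/-- Every countable locally finite group admits a global selector; in fact it carries a
well-order for which `f A = min A` is such a selector. -/
theorem globalSelector_of_countable_locallyFinite (G : Type*) [Group G] [Countable G]
    (hlf : ∀ S : Finset G, ((Subgroup.closure (S : Set G) : Subgroup G) : Set G).Finite) :
    ∃ (lo : LinearOrder G) (f : Set G → G),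
      WellFounded lo.lt ∧ IsGlobalSelector G f ∧
      ∀ A : Set G, A.Nonempty → ∀ a ∈ A, lo.le (f A) a := by
  classical
  obtain ⟨e0, he0⟩ := exists_injective_nat G
  obtain ⟨e, he, he1⟩ : ∃ e : G → ℕ, Function.Injective e ∧ e 1 = 0 :=
    ⟨fun z => Equiv.swap (e0 1) 0 (e0 z), (Equiv.injective _).comp he0, by simp⟩
  let H : ℕ → Subgroup G := fun n => Subgroup.closure {z | e z < n}
  have Hmono : ∀ {a b : ℕ}, a ≤ b → H a ≤ H b := fun {a b} hab =>
    Subgroup.closure_mono (fun z (hz : e z < a) => lt_of_lt_of_le hz hab)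
  have Hfin : ∀ n, ((H n : Subgroup G) : Set G).Finite := by
    intro n
    have h1 : ({z | e z < n} : Set G).Finite :=
      Set.Finite.preimage he.injOn (Set.finite_Iio n)
    have := hlf h1.toFinset
    rwa [Set.Finite.coe_toFinset] at this
  have Hmem : ∀ {z : G} {n : ℕ}, e z < n → z ∈ H n := fun {z n} h =>
    Subgroup.subset_closure h
  let m : ℕ → G → ℕ := fun n x => sInf (e '' {z | z * x⁻¹ ∈ H n})
  have m_eq : ∀ {n : ℕ} {x y : G}, x * y⁻¹ ∈ H n → m n x = m n y := by
    intro n x y h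
    have : {z | z * x⁻¹ ∈ H n} = {z | z * y⁻¹ ∈ H n} := by
      ext z
      have hz : z * y⁻¹ = (z * x⁻¹) * (x * y⁻¹) := by group
      simp only [Set.mem_ofPred_eq]
      rw [hz]
      exact (Subgroup.mul_mem_cancel_right _ h).symm
    simp only [m, this]
  have m_spec : ∀ (n : ℕ) (x : G), ∃ z, z * x⁻¹ ∈ H n ∧ e z = m n x := by
    intro n x
    have hne : (e '' {z | z * x⁻¹ ∈ H n}).Nonempty :=
      ⟨e x, x, by simp [(H n).one_mem], rfl⟩
    obtain ⟨z, hz, hz'⟩ := Nat.sInf_mem hne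
    exact ⟨z, hz, hz'⟩
  have eq_m : ∀ {n : ℕ} {x y : G}, m n x = m n y → x * y⁻¹ ∈ H n := by
    intro n x y h
    obtain ⟨z, hz, hz'⟩ := m_spec n x
    obtain ⟨w, hw, hw'⟩ := m_spec n y
    have : z = w := he (by rw [hz', hw', h])
    subst this
    have := (H n).mul_mem ((H n).inv_mem hz) hw
    simpa [mul_assoc] using this
  have H0 : H 0 = ⊥ := by simp [H]
  have m_inj : ∀ {x y : G}, m 0 x = m 0 y → x = y := by
    intro x y h
    have := eq_m h
    rw [H0, Subgroup.mem_bot] at this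
    exact mul_inv_eq_one.mp this
  have m_zero : ∀ {n : ℕ} {x : G}, e x < n → m n x = 0 := by
    intro n x h
    have : m n x = m n 1 := m_eq (by simpa using Hmem h)
    rw [this]
    exact Nat.sInf_eq_zero.mpr (Or.inl ⟨1, by simp [(H n).one_mem], he1⟩)
  let φ : G → Lex (ℕᵒᵈ →₀ ℕ) := fun x => toLex
    (Finsupp.onFinset ((Finset.range (e x + 1)).map OrderDual.toDual.toEmbedding)
      (fun n => m (OrderDual.ofDual n) x) (by
        intro n hn
        by_contra hc
        apply hn
        apply m_zero
        by_contra hlt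
        apply hc
        rw [Finset.mem_map]
        exact ⟨OrderDual.ofDual n, by rw [Finset.mem_range]; omega, rfl⟩))
  have φ_app : ∀ x (n : ℕ), ofLex (φ x) (OrderDual.toDual n) = m n x := fun x n => rfl
  have φ_inj : Function.Injective φ := by
    intro x y h
    apply m_inj
    rw [← φ_app, ← φ_app, h]
  have φ_lt : ∀ x y, φ x < φ y ↔ ∃ j, (∀ k, j < k → m k x = m k y) ∧ m j x < m j y := by
    intro x y
    rw [Finsupp.Lex.lt_iff]
    rfl
  let lo : LinearOrder G := LinearOrder.lift' φ φ_inj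
  have wf : WellFounded lo.lt := InvImage.wf φ (wellFounded_lt)
  let f : Set G → G := fun A => if h : A.Nonempty then wf.min A h else 1
  have f_mem : ∀ A : Set G, A.Nonempty → f A ∈ A := by
    intro A h
    simp only [f, dif_pos h]
    exact wf.min_mem A h
  have f_le : ∀ A : Set G, A.Nonempty → ∀ a ∈ A, φ (f A) ≤ φ a := by
    intro A h a ha
    simp only [f, dif_pos h]
    exact not_lt.mp (wf.not_lt_min A ha)
  have key : ∀ {n : ℕ} {x y x' y' : G}, φ x < φ y → m n x ≠ m n y → m n x' = m n x →
      m n y' = m n y → φ x' < φ y' := by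
    intro n x y x' y' h hne hx hy
    obtain ⟨j, hj, hlt⟩ := (φ_lt x y).mp h
    have hnj : n ≤ j := by
      by_contra hc
      exact hne (hj n (by omega))
    have up : ∀ {u v : G} {k : ℕ}, n ≤ k → m n u = m n v → m k u = m k v :=
      fun hk huv => m_eq (Hmono hk (eq_m huv))
    refine (φ_lt x' y').mpr ⟨j, fun k hk => ?_, ?_⟩
    · rw [up (by omega) hx, up (by omega) hy, hj k hk]
    · rw [up hnj hx, up hnj hy]; exact hlt
  refine ⟨lo, f, wf, ⟨f_mem, ?_⟩, f_le⟩
  intro F _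
  obtain ⟨n, hn⟩ : ∃ n, ∀ g ∈ F, g ∈ H n :=
    ⟨F.sup e + 1, fun g hg => Hmem (Nat.lt_succ_of_le (Finset.le_sup hg))⟩
  refine ⟨(Hfin n).toFinset, by simp [(H n).one_mem], ?_⟩
  intro A B hA hB hAB hBA
  refine ⟨f A * (f B)⁻¹, ?_, by group⟩
  rw [Set.Finite.mem_toFinset]
  apply eq_m
  by_contra hne
  obtain ⟨g, hg, b', hb', hgb⟩ := Set.mem_mul.mp (hAB (f_mem A hA))
  obtain ⟨g', hg', a', ha', hga⟩ := Set.mem_mul.mp (hBA (f_mem B hB))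
  have e1 : m n (f A) = m n b' := m_eq (by rw [← hgb]; simpa using hn g hg)
  have e2 : m n (f B) = m n a' := m_eq (by rw [← hga]; simpa using hn g' hg')
  have hlt : φ (f A) < φ a' := by
    refine lt_of_le_of_ne (f_le A hA a' ha') (fun h => hne ?_)
    rw [e2, φ_inj h]
  have := key hlt (by rw [← e2]; exact hne) e1.symm e2
  exact absurd (f_le B hB b' hb') (not_le.mpr this)
end

section
/- For a connected locally finite graph Γ with vertex set V and path metric d, the following are equivalent: (i) Γ admits a finitary selector; (ii) Γ admits a 2-selector; (iii) V is finite, or (V,d) is quasi-isometric to ℕ with its standard metric, or (V,d) is quasi-isometric to ℤ with its standard metric. -/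
/-- Two nonempty finite sets of vertices are within Hausdorff distance `n`
(with respect to the path metric `Γ.dist`). -/
def HClose {V : Type*} (Γ : SimpleGraph V) (A B : Finset V) (n : ℕ) : Prop :=
  (∀ a ∈ A, ∃ b ∈ B, Γ.dist a b ≤ n) ∧ (∀ b ∈ B, ∃ a ∈ A, Γ.dist a b ≤ n)

/-- A finitary selector of a graph `Γ`: a macro-uniform choice of a point of each
nonempty finite set of vertices. -/
def GraphFinSelector {V : Type*} (Γ : SimpleGraph V) (f : Finset V → V) : Prop :=
  (∀ A : Finset V, A.Nonempty → f A ∈ A) ∧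
  ∀ n : ℕ, ∃ m : ℕ, ∀ A B : Finset V, A.Nonempty → B.Nonempty →
    HClose Γ A B n → Γ.dist (f A) (f B) ≤ m

/-- A 2-selector of a graph `Γ`: a macro-uniform choice of a point of each
2-element set of vertices. -/
def GraphTwoSelector {V : Type*} (Γ : SimpleGraph V) (f : Finset V → V) : Prop :=
  (∀ A : Finset V, A.card = 2 → f A ∈ A) ∧
  ∀ n : ℕ, ∃ m : ℕ, ∀ A B : Finset V, A.card = 2 → B.card = 2 →
    HClose Γ A B n → Γ.dist (f A) (f B) ≤ m

/-- Quasi-isometry of `(X, dX)` and `(Y, dY)`. -/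
def QuasiIsometric {X Y : Type*} (dX : X → X → ℝ) (dY : Y → Y → ℝ) : Prop :=
  ∃ (f : X → Y) (L C : ℝ), 1 ≤ L ∧ 0 ≤ C ∧
    (∀ x x' : X, (1 / L) * dX x x' - C ≤ dY (f x) (f x') ∧
      dY (f x) (f x') ≤ L * dX x x' + C) ∧
    (∀ y : Y, ∃ x : X, dY (f x) y ≤ C)

section helpers
variable {V : Type*}

/-- selector from a real-valued coarse coordinate -/
theorem sel_of_coord (Γ : SimpleGraph V) (hne : Nonempty V) (h : V → ℝ) (L C : ℝ)
    (hL : 1 ≤ L) 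
    (hh : ∀ x x' : V, (1 / L) * (Γ.dist x x' : ℝ) - C ≤ |h x - h x'| ∧
      |h x - h x'| ≤ L * (Γ.dist x x' : ℝ) + C) :
    ∃ f : Finset V → V, GraphFinSelector Γ f := by
  have hex : ∀ A : Finset V, ∃ a : V, A.Nonempty → a ∈ A ∧ ∀ b ∈ A, h a ≤ h b := by
    intro A
    by_cases hA : A.Nonempty
    · obtain ⟨a, ha, hb⟩ := Finset.exists_min_image A h hA
      exact ⟨a, fun _ => ⟨ha, hb⟩⟩
    · exact ⟨hne.some, fun h => absurd h hA⟩
  choose f hf using hex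
  refine ⟨f, fun A hA => (hf A hA).1, fun n => ?_⟩
  obtain ⟨m, hm⟩ := exists_nat_ge (L * (L * n + C + C))
  refine ⟨m, fun A B hA hB hAB => ?_⟩
  obtain ⟨hfA, hminA⟩ := hf A hA
  obtain ⟨hfB, hminB⟩ := hf B hB
  have key : |h (f A) - h (f B)| ≤ L * n + C := by
    rw [abs_sub_le_iff]
    constructor
    · obtain ⟨a, ha, hd⟩ := hAB.2 _ hfB
      have h1 := hminA a ha
      have h2 := (hh a (f B)).2
      have h3 : (Γ.dist a (f B) : ℝ) ≤ n := by exact_mod_cast hd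
      have h4 := le_abs_self (h a - h (f B))
      nlinarith
    · obtain ⟨b, hb, hd⟩ := hAB.1 _ hfA
      have h1 := hminB b hb
      have h2 := (hh (f A) b).2
      have h3 : (Γ.dist (f A) b : ℝ) ≤ n := by exact_mod_cast hd
      have h4 := neg_abs_le (h (f A) - h b)
      nlinarith
  have h5 := (hh (f A) (f B)).1
  have h6 : (1 / L) * (Γ.dist (f A) (f B) : ℝ) ≤ L * n + C + C := by linarith
  have hL0 : 0 < L := by linarith
  have h7 : (Γ.dist (f A) (f B) : ℝ) ≤ L * (L * n + C + C) := by
    rw [one_div, inv_mul_le_iff₀ hL0] at h6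
    exact h6
  exact_mod_cast h7.trans hm

theorem sel_of_finite (Γ : SimpleGraph V) (hne : Nonempty V) (hfin : Finite V) :
    ∃ f : Finset V → V, GraphFinSelector Γ f := by
  classical
  have hex : ∀ A : Finset V, ∃ a : V, A.Nonempty → a ∈ A := by
    intro A
    by_cases hA : A.Nonempty
    · exact ⟨hA.choose, fun _ => hA.choose_spec⟩
    · exact ⟨hne.some, fun h => absurd h hA⟩
  choose f hf using hex
  refine ⟨f, hf, fun n => ?_⟩
  obtain ⟨m, hm⟩ := (Set.finite_range (fun p : V × V => Γ.dist p.1 p.2)).bddAbove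
  exact ⟨m, fun A B _ _ _ => hm ⟨(f A, f B), rfl⟩⟩

theorem qi_of_dense {Y : Type*} (Γ : SimpleGraph V) (hconn : Γ.Connected) (dY : Y → Y → ℝ)
    (l : Y → V) (A B D : ℕ) (hA : 1 ≤ A)
    (h1 : ∀ y y', (Γ.dist (l y) (l y') : ℝ) ≤ dY y y')
    (h2 : ∀ y y', dY y y' ≤ A * (Γ.dist (l y) (l y') : ℝ) + B)
    (h3 : ∀ p, ∃ y, Γ.dist p (l y) ≤ D) :
    QuasiIsometric (fun x y : V => (Γ.dist x y : ℝ)) dY := by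
  choose g hg using h3
  have hA' : (1 : ℝ) ≤ A := by exact_mod_cast hA
  have hB' : (0 : ℝ) ≤ B := by positivity
  have hD' : (0 : ℝ) ≤ D := by positivity
  refine ⟨g, A, A * (2 * D) + B, hA', by positivity, ?_, ?_⟩
  · intro x x'
    have a1 : Γ.dist x x' ≤ Γ.dist (l (g x)) (l (g x')) + 2 * D := by
      have := hconn.dist_triangle (u := x) (v := l (g x)) (w := x')
      have := hconn.dist_triangle (u := l (g x)) (v := l (g x')) (w := x')
      have e := hg x'
      rw [SimpleGraph.dist_comm] at e
      have := hg x
      omega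
    have a2 : Γ.dist (l (g x)) (l (g x')) ≤ Γ.dist x x' + 2 * D := by
      have := hconn.dist_triangle (u := l (g x)) (v := x) (w := l (g x'))
      have := hconn.dist_triangle (u := x) (v := x') (w := l (g x'))
      have e := hg x
      rw [SimpleGraph.dist_comm] at e
      have := hg x'
      omega
    have a1' : (Γ.dist x x' : ℝ) ≤ Γ.dist (l (g x)) (l (g x')) + 2 * D := by exact_mod_cast a1
    have a2' : (Γ.dist (l (g x)) (l (g x')) : ℝ) ≤ Γ.dist x x' + 2 * D := by exact_mod_cast a2
    constructor
    · have b1 := h1 (g x) (g x')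
      have b2 : (1 / (A : ℝ)) * (Γ.dist x x' : ℝ) ≤ Γ.dist x x' := by
        apply mul_le_of_le_one_left (by positivity)
        rw [div_le_one (by linarith)]; exact hA'
      show (1 / (A : ℝ)) * (Γ.dist x x' : ℝ) - (A * (2 * D) + B) ≤ dY (g x) (g x')
      nlinarith
    · have b1 := h2 (g x) (g x')
      show dY (g x) (g x') ≤ A * (Γ.dist x x' : ℝ) + (A * (2 * D) + B)
      nlinarith
  · intro y
    refine ⟨l y, ?_⟩
    have b1 := h2 (g (l y)) y
    have e : (Γ.dist (l (g (l y))) (l y) : ℝ) ≤ D := by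
      rw [SimpleGraph.dist_comm]; exact_mod_cast hg (l y)
    nlinarith

theorem ray_exists (Γ : SimpleGraph V) (hconn : Γ.Connected)
    (hlf : ∀ v : V, (Γ.neighborSet v).Finite) (v0 : V) (F : Set V) (hF : F.Infinite) :
    ∃ r : ℕ → V, r 0 = v0 ∧ (∀ i, Γ.Adj (r i) (r (i+1))) ∧ (∀ i, Γ.dist v0 (r i) = i) ∧
      ∀ i, ∃ p ∈ F, Γ.dist v0 p = i + Γ.dist (r i) p := by
  let P : V → Prop := fun v => {p ∈ F | Γ.dist v0 p = Γ.dist v0 v + Γ.dist v p}.Infinite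
  have hP0 : P v0 := by
    have : {p ∈ F | Γ.dist v0 p = Γ.dist v0 v0 + Γ.dist v0 p} = F := by
      ext p; simp
    show Set.Infinite _
    rw [this]; exact hF
  have step : ∀ v : {v // P v}, ∃ w : {v // P v}, Γ.Adj v w ∧
      Γ.dist v0 w = Γ.dist v0 v + 1 := by
    rintro ⟨v, hv⟩
    by_contra hcon
    push Not at hcon
    apply hv
    have hsub : {p ∈ F | Γ.dist v0 p = Γ.dist v0 v + Γ.dist v p} ⊆
        {v} ∪ ⋃ w ∈ {w ∈ Γ.neighborSet v | Γ.dist v0 w = Γ.dist v0 v + 1},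
          {p ∈ F | Γ.dist v0 p = Γ.dist v0 w + Γ.dist w p} := by
      rintro p ⟨hpF, hp⟩
      by_cases hpv : p = v
      · left; exact hpv
      right
      obtain ⟨W, hW⟩ := hconn.exists_walk_length_eq_dist v p
      cases W with
      | nil => exact absurd rfl hpv
      | @cons _ w _ hadj W' =>
        have e1 : Γ.dist w p ≤ W'.length := SimpleGraph.dist_le W'
        rw [SimpleGraph.Walk.length_cons] at hW
        have e2 := hconn.dist_triangle (u := v0) (v := w) (w := p)
        have e3 := hconn.dist_triangle (u := v0) (v := v) (w := w)
        have e4 : Γ.dist v w = 1 := SimpleGraph.dist_eq_one_iff_adj.2 hadj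
        simp only [Set.mem_iUnion]
        exact ⟨w, ⟨hadj, by omega⟩, hpF, by omega⟩
    refine Set.Finite.subset ?_ hsub
    refine (Set.finite_singleton v).union (Set.Finite.biUnion ((hlf v).subset (fun w hw => hw.1)) ?_)
    rintro w ⟨hw, hd⟩
    by_contra hinf
    exact hcon ⟨w, hinf⟩ hw hd
  choose nx hnx using step
  let s : ℕ → {v // P v} := fun n => Nat.rec ⟨v0, hP0⟩ (fun _ v => nx v) n
  have hs : ∀ n, s (n+1) = nx (s n) := fun n => rfl
  have hd : ∀ i, Γ.dist v0 (s i).1 = i := by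
    intro i
    induction i with
    | zero => show Γ.dist v0 v0 = 0; simp
    | succ n ih => rw [hs, (hnx (s n)).2, ih]
  refine ⟨fun n => (s n).1, rfl, fun i => ?_, hd, fun i => ?_⟩
  · show Γ.Adj (s i).1 (s (i+1)).1
    rw [hs]; exact (hnx (s i)).1
  · obtain ⟨p, hp, hq⟩ := (s i).2.nonempty
    rw [hd] at hq
    exact ⟨p, hp, hq⟩

theorem ray_lip (Γ : SimpleGraph V) (hconn : Γ.Connected) (r : ℕ → V)
    (h : ∀ i, Γ.Adj (r i) (r (i+1))) (i j : ℕ) : Γ.dist (r i) (r (i+j)) ≤ j := by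
  induction j with
  | zero => simp
  | succ n ih =>
    have e3 := hconn.dist_triangle (u := r i) (v := r (i+n)) (w := r (i+n+1))
    have e4 : Γ.dist (r (i+n)) (r (i+n+1)) = 1 := SimpleGraph.dist_eq_one_iff_adj.2 (h _)
    rw [← add_assoc]; omega

theorem geod_exists (Γ : SimpleGraph V) (hconn : Γ.Connected) (v p : V) :
    ∃ g : ℕ → V, g 0 = v ∧ (∀ i, Γ.dist (g i) (g (i+1)) ≤ 1) ∧
      (∀ i, Γ.dist v (g i) ≤ i) ∧
      ∀ i, i ≤ Γ.dist v p → Γ.dist (g i) p + i ≤ Γ.dist v p := by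
  obtain ⟨W, hW⟩ := hconn.exists_walk_length_eq_dist v p
  have hstep : ∀ i, Γ.dist (W.getVert i) (W.getVert (i+1)) ≤ 1 := by
    intro i
    by_cases hi : i < W.length
    · exact (SimpleGraph.dist_eq_one_iff_adj.2 (W.adj_getVert_succ hi)).le
    · rw [W.getVert_of_length_le (by omega), W.getVert_of_length_le (by omega)]; simp
  refine ⟨W.getVert, by simp, hstep, ?_, ?_⟩
  · intro i
    induction i with
    | zero => simp
    | succ n ih =>
      have e3 := hconn.dist_triangle (u := v) (v := W.getVert n) (w := W.getVert (n+1))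
      have := hstep n
      omega
  · intro i hi
    have := SimpleGraph.dist_le (W.drop i)
    rw [SimpleGraph.Walk.drop_length] at this
    omega

theorem move_path [DecidableEq V] (Γ : SimpleGraph V) (f : Finset V → V)
    (hf : ∀ A : Finset V, A.card = 2 → f A ∈ A) (m : ℕ)
    (hm : ∀ A B : Finset V, A.card = 2 → B.card = 2 →
      HClose Γ A B 1 → Γ.dist (f A) (f B) ≤ m) (b : V) (g : ℕ → V)
    (hg : ∀ i, Γ.dist (g i) (g (i+1)) ≤ 1) (n : ℕ) (hn : ∀ i ≤ n, m < Γ.dist (g i) b) :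
    f {g 0, b} = g 0 ↔ f {g n, b} = g n := by
  induction n with
  | zero => rfl
  | succ n ih =>
    rw [ih (fun i hi => hn i (by omega))]
    have d1 := hn n (by omega)
    have d2 := hn (n+1) le_rfl
    have n1 : g n ≠ b := by rintro h; rw [h] at d1; simp at d1
    have n2 : g (n+1) ≠ b := by rintro h; rw [h] at d2; simp at d2
    have c1 := Finset.card_pair n1
    have c2 := Finset.card_pair n2
    have hc := hm _ _ c1 c2 ⟨by
      intro a ha
      simp only [Finset.mem_insert, Finset.mem_singleton] at ha
      rcases ha with rfl | rfl
      · exact ⟨g (n+1), by simp, hg n⟩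
      · exact ⟨a, by simp, by simp⟩, by
      intro a ha
      simp only [Finset.mem_insert, Finset.mem_singleton] at ha
      rcases ha with rfl | rfl
      · exact ⟨g n, by simp, hg n⟩
      · exact ⟨a, by simp, by simp⟩⟩
    have m1 := hf _ c1
    have m2 := hf _ c2
    simp only [Finset.mem_insert, Finset.mem_singleton] at m1 m2
    constructor
    · intro h
      rcases m2 with h' | h'
      · exact h'
      · rw [h, h'] at hc; omega
    · intro h
      rcases m1 with h' | h'
      · exact h'
      · rw [h, h', SimpleGraph.dist_comm] at hc; omega

theorem tripod_half [DecidableEq V] (Γ : SimpleGraph V) (hconn : Γ.Connected) (f : Finset V → V)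
    (hf : ∀ A : Finset V, A.card = 2 → f A ∈ A) (m : ℕ)
    (hm : ∀ A B : Finset V, A.card = 2 → B.card = 2 →
      HClose Γ A B 1 → Γ.dist (f A) (f B) ≤ m)
    (l : ℤ → V) (hl : ∀ i, Γ.dist (l i) (l (i+1)) ≤ 1) (k : ℤ) (T B : ℕ)
    (hT : 6 * m + B + 6 ≤ T)
    (hlow : ∀ i j, k - T ≤ i → i ≤ j → j ≤ k + T → j - i ≤ 3 * (Γ.dist (l i) (l j) : ℤ) + B)
    (g : ℕ → V) (g0 : g 0 = l k) (hg : ∀ i, Γ.dist (g i) (g (i+1)) ≤ 1)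
    (hg1 : ∀ i, Γ.dist (l k) (g i) ≤ i)
    (hg2 : ∀ i ≤ T, ∀ j, i ≤ Γ.dist (g i) (l j)) :
    f {l (k - T), l (k + T)} = l (k - T) ↔ f {g T, l (k+T)} = g T := by
  have p1 := move_path Γ f hf m hm (l (k+T)) (fun i : ℕ => l (k - T + i))
    (fun i => by have := hl (k - T + i); push_cast; rw [← add_assoc]; exact this) T (by
      intro i hi
      have := hlow (k - T + i) (k + T) (by omega) (by omega) (by omega)
      show m < Γ.dist (l (k - T + i)) (l (k+T))
      omega)
  have p2 := move_path Γ f hf m hm (l (k+T)) g hg T (by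
      intro i hi
      have a1 := hlow k (k + T) (by omega) (by omega) (by omega)
      have a2 := hg2 i hi (k+T)
      have a3 := hconn.dist_triangle (u := l k) (v := g i) (w := l (k+T))
      have a4 := hg1 i
      omega)
  simp only [Nat.cast_zero, add_zero, sub_add_cancel] at p1
  rw [g0] at p2
  exact p1.trans p2

theorem tripod [DecidableEq V] (Γ : SimpleGraph V) (hconn : Γ.Connected) (f : Finset V → V)
    (hf : ∀ A : Finset V, A.card = 2 → f A ∈ A) (m : ℕ)
    (hm : ∀ A B : Finset V, A.card = 2 → B.card = 2 →
      HClose Γ A B 1 → Γ.dist (f A) (f B) ≤ m)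
    (l : ℤ → V) (hl : ∀ i, Γ.dist (l i) (l (i+1)) ≤ 1) (k : ℤ) (T B : ℕ)
    (hT : 6 * m + B + 6 ≤ T)
    (hlow : ∀ i j, k - T ≤ i → i ≤ j → j ≤ k + T → j - i ≤ 3 * (Γ.dist (l i) (l j) : ℤ) + B)
    (p : V) (hp : ∀ j, Γ.dist p (l k) ≤ Γ.dist p (l j)) : Γ.dist p (l k) < T := by
  by_contra hN
  push Not at hN
  obtain ⟨g, g0, hg, hg1, hg3⟩ := geod_exists Γ hconn (l k) p
  rw [SimpleGraph.dist_comm] at hN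
  have hg2 : ∀ i ≤ T, ∀ j, i ≤ Γ.dist (g i) (l j) := by
    intro i hi j
    have a1 := hg3 i (by omega)
    have a2 := hp j
    have a3 := hconn.dist_triangle (u := p) (v := g i) (w := l j)
    rw [SimpleGraph.dist_comm (u := p) (v := g i)] at a3
    rw [SimpleGraph.dist_comm (u := p) (v := l k)] at a2
    omega
  have q1 := tripod_half Γ hconn f hf m hm l hl k T B hT hlow g g0 hg hg1 hg2
  have q2 := tripod_half Γ hconn f hf m hm (fun i => l (2 * k - i)) (by
    intro i
    have := hl (2 * k - (i + 1))
    rw [SimpleGraph.dist_comm]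
    convert this using 3
    ring) k T B hT (by
    intro i j h1 h2 h3
    have := hlow (2 * k - j) (2 * k - i) (by omega) (by omega) (by omega)
    rw [SimpleGraph.dist_comm] at this
    show j - i ≤ 3 * (Γ.dist (l (2 * k - i)) (l (2 * k - j)) : ℤ) + B
    omega) g (by rw [g0]; congr 1; ring) hg (by
      have : 2 * k - k = k := by ring
      simp only [this]; exact hg1) (fun i hi j => hg2 i hi _)
  have e1 : 2 * k - (k - T) = k + T := by ring
  have e2 : 2 * k - (k + T) = k - T := by ring
  simp only [e1, e2] at q2
  have hd := hlow (k - T) (k + T) (by omega) (by omega) (by omega)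
  have hne : l (k - T) ≠ l (k + T) := by
    intro h; rw [h] at hd; simp at hd; omega
  -- move the other point
  have q3 := move_path Γ f hf m hm (g T) (fun i : ℕ => l (k - T + i))
    (fun i => by have := hl (k - T + i); push_cast; rw [← add_assoc]; exact this) (2 * T) (by
      intro i hi
      have := hg2 T le_rfl (k - T + i)
      rw [SimpleGraph.dist_comm] at this
      show m < Γ.dist (l (k - T + i)) (g T)
      omega)
  have e3 : k - T + ((2 * T : ℕ) : ℤ) = k + T := by push_cast; ring
  simp only [Nat.cast_zero, add_zero, e3] at q3
  have nn : ∀ j, g T ≠ l j := by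
    intro j h
    have := hg2 T le_rfl j
    rw [h] at this; simp at this; omega
  have flip : ∀ a b : V, a ≠ b → (f {a, b} = a ↔ ¬ f {b, a} = b) := by
    intro a b hab
    have := hf _ (Finset.card_pair hab)
    simp only [Finset.mem_insert, Finset.mem_singleton] at this
    rw [Finset.pair_comm b a]
    constructor
    · intro h h'; exact hab (h.symm.trans h')
    · intro h; tauto
  have r1 := flip _ _ (nn (k - T))
  have r2 := flip _ _ (nn (k + T))
  have r3 := flip _ _ hne
  tauto

theorem nearest_exists {Y : Type*} [Nonempty Y] (Γ : SimpleGraph V) (l : Y → V) (p : V) :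
    ∃ k, ∀ j, Γ.dist p (l k) ≤ Γ.dist p (l j) := by
  let φ : Y → ℕ := fun j => Γ.dist p (l j)
  refine ⟨Function.argmin φ, fun j => ?_⟩
  exact Function.argmin_le φ j

theorem main_dir (Γ : SimpleGraph V)
    (hconn : Γ.Connected) (hlf : ∀ v : V, (Γ.neighborSet v).Finite)
    (f : Finset V → V) (hf : GraphTwoSelector Γ f) (hinf : Infinite V) :
        QuasiIsometric (fun x y : V => (Γ.dist x y : ℝ))
          (fun a b : ℕ => |(a : ℝ) - (b : ℝ)|) ∨
        QuasiIsometric (fun x y : V => (Γ.dist x y : ℝ))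
          (fun a b : ℤ => |(a : ℝ) - (b : ℝ)|) := by
  classical
  obtain ⟨hf, hfm⟩ := hf
  obtain ⟨m, hm⟩ := hfm 1
  obtain ⟨v0⟩ := hconn.nonempty
  have tri := fun u v w => hconn.dist_triangle (u := u) (v := v) (w := w)
  have comm := fun u v => SimpleGraph.dist_comm (G := Γ) (u := u) (v := v)
  have raydist : ∀ r : ℕ → V, (∀ i, Γ.Adj (r i) (r (i+1))) → (∀ i, Γ.dist v0 (r i) = i) →
      ∀ i j, i ≤ j → Γ.dist (r i) (r j) = j - i := by
    intro r hr hr' i j hij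
    obtain ⟨c, rfl⟩ := Nat.exists_eq_add_of_le hij
    have a1 := ray_lip Γ hconn r hr i c
    have a2 := tri v0 (r i) (r (i+c))
    rw [hr', hr'] at a2
    omega
  obtain ⟨r, r0, radj, rd, -⟩ := ray_exists Γ hconn hlf v0 Set.univ Set.infinite_univ
  have rdist := raydist r radj rd
  have lipZ : ∀ (r : ℕ → V), (∀ i, Γ.Adj (r i) (r (i+1))) → ∀ i, Γ.dist (r i) (r (i+1)) ≤ 1 :=
    fun r hr i => (SimpleGraph.dist_eq_one_iff_adj.2 (hr i)).le
  obtain ⟨S, hS⟩ : ∃ S, S = 6 * m + 6 := ⟨_, rfl⟩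
  have stage1 : ∀ p, ∀ k, (∀ j, Γ.dist p (r k) ≤ Γ.dist p (r j)) → S ≤ Γ.dist p (r k) → k < S := by
    intro p k hk hp
    by_contra hkS
    have := tripod Γ hconn f hf m hm (fun z : ℤ => r z.toNat) (by
      intro i
      show Γ.dist (r i.toNat) (r (i+1).toNat) ≤ 1
      by_cases hi : 0 ≤ i
      · have : (i+1).toNat = i.toNat + 1 := by omega
        rw [this]; exact lipZ r radj _
      · have : (i+1).toNat = i.toNat := by omega
        rw [this]; simp) k S 0 (by omega) (by
      intro i j h1 h2 h3
      show j - i ≤ 3 * (Γ.dist (r i.toNat) (r j.toNat) : ℤ) + (0 : ℕ)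
      rw [rdist _ _ (by omega)]
      omega) p (fun j => by simpa using hk j.toNat)
    simp at this
    omega
  by_cases hF : {p : V | ∀ j, S ≤ Γ.dist p (r j)}.Finite
  · left
    obtain ⟨D, hD⟩ := (hF.image (fun p => Γ.dist p (r 0))).bddAbove
    have hcast : ∀ y y' : ℕ, (Γ.dist (r y) (r y') : ℝ) = |(y : ℝ) - (y' : ℝ)| := by
      intro y y'
      rcases le_total y y' with h | h
      · rw [rdist _ _ h, abs_sub_comm, abs_of_nonneg (by simpa using h), Nat.cast_sub h]
      · rw [comm, rdist _ _ h, abs_of_nonneg (by simpa using h), Nat.cast_sub h]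
    refine qi_of_dense Γ hconn _ r 1 0 (S + D) le_rfl (fun y y' => (hcast y y').le)
      (fun y y' => by rw [hcast]; simp) ?_
    intro p
    by_cases hp : ∀ j, S ≤ Γ.dist p (r j)
    · exact ⟨0, le_trans (hD ⟨p, hp, rfl⟩) (by omega)⟩
    · push Not at hp
      obtain ⟨j, hj⟩ := hp
      exact ⟨j, by omega⟩
  · right
    obtain ⟨s, s0, sadj, sd, hs⟩ := ray_exists Γ hconn hlf v0 _ hF
    have sdist := raydist s sadj sd
    have sep : ∀ i j, i ≤ Γ.dist (s i) (r j) + S := by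
      intro i j
      obtain ⟨p, hp, hpd⟩ := hs i
      obtain ⟨k, hk⟩ := nearest_exists Γ r p
      have hkS := stage1 p k hk (hp k)
      have a1 := tri v0 (r k) p
      rw [rd, comm (r k) p] at a1
      have a2 := hk j
      have a3 := tri p (s i) (r j)
      rw [comm p (s i)] at a3
      omega
    have cross : ∀ i j, i + j ≤ 3 * Γ.dist (s i) (r j) + 2 * S := by
      intro i j
      have a1 := sep i j
      have a2 := tri v0 (s i) (r j)
      rw [rd, sd] at a2
      omega
    obtain ⟨l, hldef⟩ : ∃ l : ℤ → V, l = fun z => if 0 ≤ z then r z.toNat else s (-z).toNat :=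
      ⟨_, rfl⟩
    have lpos : ∀ z : ℤ, 0 ≤ z → l z = r z.toNat := by
      intro z hz; rw [hldef]; simp only [hz, if_true]
    have lneg : ∀ z : ℤ, z ≤ 0 → l z = s (-z).toNat := by
      intro z hz
      by_cases h : z = 0
      · subst h; rw [lpos 0 le_rfl]; simp [r0, s0]
      · rw [hldef]; simp only [show ¬ (0 ≤ z) by omega, if_false]
    have hup : ∀ i j, i ≤ j → (Γ.dist (l i) (l j) : ℤ) ≤ j - i := by
      intro i j hij
      rcases le_total 0 i with h | h
      · rw [lpos i h, lpos j (by omega), rdist _ _ (by omega)]; omega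
      · rcases le_total j 0 with h' | h'
        · rw [lneg i h, lneg j h', comm, sdist _ _ (by omega)]; omega
        · rw [lneg i h, lpos j h']
          have a1 := tri (s (-i).toNat) v0 (r j.toNat)
          rw [comm _ v0, sd, rd] at a1
          omega
    have hlow : ∀ i j, i ≤ j → j - i ≤ 3 * (Γ.dist (l i) (l j) : ℤ) + (2 * S : ℕ) := by
      intro i j hij
      rcases le_total 0 i with h | h
      · rw [lpos i h, lpos j (by omega), rdist _ _ (by omega)]; omega
      · rcases le_total j 0 with h' | h'
        · rw [lneg i h, lneg j h', comm, sdist _ _ (by omega)]; omega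
        · rw [lneg i h, lpos j h']
          have a1 := cross (-i).toNat j.toNat
          omega
    have habs1 : ∀ i j : ℤ, (Γ.dist (l i) (l j) : ℤ) ≤ |i - j| := by
      intro i j
      rcases le_total i j with h | h
      · have := hup i j h
        rw [abs_of_nonpos (by omega)]; omega
      · have := hup j i h
        rw [abs_of_nonneg (by omega), comm]; omega
    have habs2 : ∀ i j : ℤ, |i - j| ≤ 3 * (Γ.dist (l i) (l j) : ℤ) + (2 * S : ℕ) := by
      intro i j
      rcases le_total i j with h | h
      · have := hlow i j h
        rw [abs_of_nonpos (by omega)]; omega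
      · have := hlow j i h
        rw [abs_of_nonneg (by omega), comm]; omega
    refine qi_of_dense Γ hconn _ l 3 (2 * S) (6 * m + 2 * S + 6) (by norm_num) ?_ ?_ ?_
    · intro y y'; exact_mod_cast habs1 y y'
    · intro y y'; exact_mod_cast habs2 y y'
    · intro p
      obtain ⟨k, hk⟩ := nearest_exists Γ l p
      refine ⟨k, le_of_lt ?_⟩
      exact tripod Γ hconn f hf m hm l (fun i => by have := hup i (i+1) (by omega); omega) k
        (6 * m + 2 * S + 6) (2 * S) le_rfl (fun i j _ h _ => hlow i j h) p hk

end helpers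

theorem graph_selector_characterization {V : Type*} (Γ : SimpleGraph V)
    (hconn : Γ.Connected) (hlf : ∀ v : V, (Γ.neighborSet v).Finite) :
    ((∃ f : Finset V → V, GraphFinSelector Γ f) ↔
      (∃ f : Finset V → V, GraphTwoSelector Γ f)) ∧
    ((∃ f : Finset V → V, GraphTwoSelector Γ f) ↔
      (Finite V ∨
        QuasiIsometric (fun x y : V => (Γ.dist x y : ℝ))
          (fun a b : ℕ => |(a : ℝ) - (b : ℝ)|) ∨
        QuasiIsometric (fun x y : V => (Γ.dist x y : ℝ))
          (fun a b : ℤ => |(a : ℝ) - (b : ℝ)|))) := by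
  have hne := hconn.nonempty
  have h12 : (∃ f : Finset V → V, GraphFinSelector Γ f) →
      (∃ f : Finset V → V, GraphTwoSelector Γ f) := by
    rintro ⟨f, h1, h2⟩
    have ne : ∀ A : Finset V, A.card = 2 → A.Nonempty := fun A hA =>
      Finset.card_pos.1 (by omega)
    refine ⟨f, fun A hA => h1 A (ne A hA), fun n => ?_⟩
    obtain ⟨m, hm⟩ := h2 n
    exact ⟨m, fun A B hA hB h => hm A B (ne A hA) (ne B hB) h⟩
  have h23 : (∃ f : Finset V → V, GraphTwoSelector Γ f) →
      (Finite V ∨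
        QuasiIsometric (fun x y : V => (Γ.dist x y : ℝ))
          (fun a b : ℕ => |(a : ℝ) - (b : ℝ)|) ∨
        QuasiIsometric (fun x y : V => (Γ.dist x y : ℝ))
          (fun a b : ℤ => |(a : ℝ) - (b : ℝ)|)) := by
    rintro ⟨f, hf⟩
    rcases finite_or_infinite V with h | h
    · exact Or.inl h
    · exact Or.inr (main_dir Γ hconn hlf f hf h)
  have h31 : (Finite V ∨
        QuasiIsometric (fun x y : V => (Γ.dist x y : ℝ))
          (fun a b : ℕ => |(a : ℝ) - (b : ℝ)|) ∨
        QuasiIsometric (fun x y : V => (Γ.dist x y : ℝ))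
          (fun a b : ℤ => |(a : ℝ) - (b : ℝ)|)) →
      (∃ f : Finset V → V, GraphFinSelector Γ f) := by
    rintro (h | ⟨h, L, C, hL, -, hh, -⟩ | ⟨h, L, C, hL, -, hh, -⟩)
    · exact sel_of_finite Γ hne h
    · exact sel_of_coord Γ hne (fun v => (h v : ℝ)) L C hL hh
    · exact sel_of_coord Γ hne (fun v => (h v : ℝ)) L C hL hh
  exact ⟨⟨h12, fun h => h31 (h23 h)⟩, ⟨h23, fun h => h12 (h31 h)⟩⟩
end

section
/- If a connected locally finite graph Γ with infinite vertex set V and path metric d admits a 2-selector, then (V,d) is quasi-isometric to ℕ or to ℤ with their standard metrics. -/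
open Classical in
theorem ts_step {V : Type*} (Γ : SimpleGraph V) (f : Finset V → V) (K : ℕ)
    (hf1 : ∀ A : Finset V, A.card = 2 → f A ∈ A)
    (hf2 : ∀ A B : Finset V, A.card = 2 → B.card = 2 →
      HClose Γ A B 1 → Γ.dist (f A) (f B) ≤ K)
    (x x' y : V) (h1 : K < Γ.dist x y) (h2 : K < Γ.dist x' y) (h : Γ.dist x x' ≤ 1)
    (hP : f {x, y} = x) : f {x', y} = x' := by
  have n1 : x ≠ y := by rintro rfl; simp at h1
  have n2 : x' ≠ y := by rintro rfl; simp at h2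
  have c1 := Finset.card_pair n1
  have c2 := Finset.card_pair n2
  have hc : HClose Γ {x, y} {x', y} 1 := by
    constructor
    · intro a ha
      simp only [Finset.mem_insert, Finset.mem_singleton] at ha
      rcases ha with rfl | rfl
      · exact ⟨x', by simp, h⟩
      · exact ⟨a, by simp, by simp⟩
    · intro a ha
      simp only [Finset.mem_insert, Finset.mem_singleton] at ha
      rcases ha with rfl | rfl
      · exact ⟨x, by simp, h⟩
      · exact ⟨a, by simp, by simp⟩
  have h3 := hf2 _ _ c1 c2 hc
  have h4 := hf1 _ c2
  simp only [Finset.mem_insert, Finset.mem_singleton] at h4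
  rcases h4 with h4 | h4
  · exact h4
  · rw [hP, h4] at h3; omega

theorem ts_lip {V : Type*} (Γ : SimpleGraph V) (hconn : Γ.Connected) (p : ℕ → V)
    (hp : ∀ i, Γ.dist (p i) (p (i+1)) ≤ 1) (i k : ℕ) : Γ.dist (p i) (p (i + k)) ≤ k := by
  induction k with
  | zero => simp
  | succ k ih =>
    have := hconn.dist_triangle (u := p i) (v := p (i+k)) (w := p (i+(k+1)))
    have := hp (i+k)
    rw [← add_assoc] at *
    omega

theorem ts_lipZ {V : Type*} (Γ : SimpleGraph V) (hconn : Γ.Connected) (p : ℤ → V)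
    (hp : ∀ i, Γ.dist (p i) (p (i+1)) ≤ 1) (i j : ℤ) : (Γ.dist (p i) (p j) : ℤ) ≤ |i - j| := by
  have key : ∀ (i : ℤ) (k : ℕ), Γ.dist (p i) (p (i + k)) ≤ k := by
    intro i k
    have := ts_lip Γ hconn (fun n : ℕ => p (i + n))
      (fun n => by have := hp (i+n); push_cast; rwa [← add_assoc]) 0 k
    simpa using this
  rcases le_total i j with h | h
  · have := key i (j-i).toNat
    rw [show i + ((j-i).toNat : ℤ) = j by omega] at this
    rw [abs_of_nonpos (by omega)]; omega
  · have := key j (i-j).toNat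
    rw [show j + ((i-j).toNat : ℤ) = i by omega, Γ.dist_comm] at this
    rw [abs_of_nonneg (by omega)]; omega

/-- geodesic path -/
theorem ts_geod {V : Type*} (Γ : SimpleGraph V) (hconn : Γ.Connected) (u v : V) :
    ∃ p : ℕ → V, p 0 = u ∧ p (Γ.dist u v) = v ∧ ∀ i, Γ.dist (p i) (p (i+1)) ≤ 1 := by
  obtain ⟨w, hw⟩ := hconn.exists_walk_length_eq_dist u v
  refine ⟨w.getVert, by simp, by rw [← hw]; simp, fun i => ?_⟩
  by_cases h : i < w.length
  · exact (SimpleGraph.dist_eq_one_iff_adj.mpr (w.adj_getVert_succ h)).le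
  · rw [w.getVert_of_length_le (by omega), w.getVert_of_length_le (by omega)]; simp

open Classical in
theorem ts_path {V : Type*} (Γ : SimpleGraph V) (f : Finset V → V) (K : ℕ)
    (hf1 : ∀ A : Finset V, A.card = 2 → f A ∈ A)
    (hf2 : ∀ A B : Finset V, A.card = 2 → B.card = 2 →
      HClose Γ A B 1 → Γ.dist (f A) (f B) ≤ K)
    (p : ℕ → V) (hp : ∀ i, Γ.dist (p i) (p (i+1)) ≤ 1) (y : V) (n : ℕ)
    (h : ∀ i ≤ n, K < Γ.dist (p i) y) : f {p 0, y} = p 0 ↔ f {p n, y} = p n := by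
  induction n with
  | zero => rfl
  | succ n ih =>
    rw [ih (fun i hi => h i (by omega))]
    constructor
    · exact ts_step Γ f K hf1 hf2 _ _ _ (h _ (by omega)) (h _ le_rfl) (hp n)
    · exact ts_step Γ f K hf1 hf2 _ _ _ (h _ le_rfl) (h _ (by omega))
        (by rw [Γ.dist_comm]; exact hp n)

open Classical in
theorem ts_swap {V : Type*} (f : Finset V → V)
    (hf1 : ∀ A : Finset V, A.card = 2 → f A ∈ A) (x y : V) (h : x ≠ y) :
    f {x, y} = x ↔ ¬ f {y, x} = y := by
  have h4 := hf1 _ (Finset.card_pair h)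
  simp only [Finset.mem_insert, Finset.mem_singleton] at h4
  rw [Finset.pair_comm y x]
  rcases h4 with h4 | h4 <;> rw [h4] <;> simp [h, h.symm]

open Classical in
theorem ts_tripod {V : Type*} (Γ : SimpleGraph V) (hconn : Γ.Connected) (f : Finset V → V) (K : ℕ)
    (hf1 : ∀ A : Finset V, A.card = 2 → f A ∈ A)
    (hf2 : ∀ A B : Finset V, A.card = 2 → B.card = 2 →
      HClose Γ A B 1 → Γ.dist (f A) (f B) ≤ K)
    (g : ℤ → V) (hg : ∀ i, Γ.dist (g i) (g (i+1)) ≤ 1) (v : V) (c : ℤ) (a : ℕ)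
    (hmin : ∀ j, Γ.dist v (g c) ≤ Γ.dist v (g j)) (hK : K < Γ.dist v (g c))
    (hR : ∀ i : ℕ, i ≤ a → 2 * K < Γ.dist (g (c - a)) (g (c + i)))
    (hL : ∀ i : ℕ, i ≤ a → 2 * K < Γ.dist (g (c + a)) (g (c - i))) : False := by
  obtain ⟨p, p0, pD, hp⟩ := ts_geod Γ hconn (g c) v
  have hgR : ∀ (b : ℤ) (i : ℕ), Γ.dist (g (b + i)) (g (b + (i + 1 : ℕ))) ≤ 1 := by
    intro b i; have := hg (b+i); push_cast; rwa [← add_assoc]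
  have hgL : ∀ (b : ℤ) (i : ℕ), Γ.dist (g (b - i)) (g (b - (i + 1 : ℕ))) ≤ 1 := by
    intro b i
    have := hg (b - (i + 1 : ℕ))
    rw [show b - ((i + 1 : ℕ) : ℤ) + 1 = b - i by push_cast; ring, Γ.dist_comm] at this
    exact this
  have leg : ∀ j : ℤ, 2 * K < Γ.dist (g j) (g c) → (f {g c, g j} = g c ↔ f {v, g j} = v) := by
    intro j hj
    have := ts_path Γ f K hf1 hf2 p hp (g j) (Γ.dist (g c) v) (by
      intro i hi
      have e1 := ts_lip Γ hconn p hp 0 i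
      have e2 := ts_lip Γ hconn p hp i (Γ.dist (g c) v - i)
      rw [show i + (Γ.dist (g c) v - i) = Γ.dist (g c) v by omega, pD] at e2
      rw [p0, zero_add] at e1
      have e3 := hconn.dist_triangle (u := v) (v := p i) (w := g j)
      have e4 := hconn.dist_triangle (u := g j) (v := p i) (w := g c)
      have e5 := hmin j
      have e6 := Γ.dist_comm (u := g j) (v := p i)
      have e7 := Γ.dist_comm (u := g c) (v := p i)
      have e8 := Γ.dist_comm (u := v) (v := p i)
      have e9 := Γ.dist_comm (u := v) (v := g c)
      omega)
    rwa [p0, pD] at this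
  have hx := hR 0 (by omega)
  have hz := hL 0 (by omega)
  have hxz := hR a le_rfl
  simp only [Nat.cast_zero, add_zero, sub_zero] at hx hz
  have s1 := ts_path Γ f K hf1 hf2 (fun i : ℕ => g (c + i)) (hgR c) (g (c - a)) a (by
    intro i hi; have := hR i hi; rw [Γ.dist_comm]; omega)
  have s2 := leg _ hx
  have s3 := ts_path Γ f K hf1 hf2 (fun i : ℕ => g (c - a + i)) (hgR _) v (2 * a) (by
    intro i hi; rw [Γ.dist_comm]; exact lt_of_lt_of_le hK (hmin _))
  have s4 := leg _ hz
  have s5 := ts_path Γ f K hf1 hf2 (fun i : ℕ => g (c - i)) (hgL c) (g (c + a)) a (by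
    intro i hi; have := hL i hi; rw [Γ.dist_comm]; omega)
  simp only [Nat.cast_zero, add_zero, sub_zero] at s1 s3 s5
  rw [show c - (a : ℤ) + ((2 * a : ℕ) : ℤ) = c + a by push_cast; ring] at s3
  have n1 : g (c - a) ≠ g (c + a) := by intro h; rw [h] at hxz; simp at hxz
  have n2 : ∀ j, g j ≠ v := by
    intro j h; have := hmin j; rw [h, SimpleGraph.dist_self] at this
    omega
  have w1 := ts_swap f hf1 _ _ n1
  have w2 := ts_swap f hf1 _ _ (n2 (c - a))
  have w3 := ts_swap f hf1 _ _ (n2 (c + a))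
  tauto

theorem ts_ray {V : Type*} (Γ : SimpleGraph V) (hconn : Γ.Connected)
    (hlf : ∀ v : V, (Γ.neighborSet v).Finite) (o : V) (S : Set V) (hS : S.Infinite) :
    ∃ r : ℕ → V, r 0 = o ∧ (∀ i, Γ.dist (r i) (r (i+1)) ≤ 1) ∧
      ∀ t, ∃ v ∈ S, Γ.dist o v = t + Γ.dist (r t) v := by
  let T : ℕ → V → Set V := fun t x => {v ∈ S | Γ.dist o v = t + Γ.dist x v}
  have step : ∀ t x, (T t x).Infinite → ∃ y, Γ.dist x y ≤ 1 ∧ (T (t+1) y).Infinite := by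
    intro t x hT
    by_contra hcon
    push Not at hcon
    apply hT
    have hfin : (⋃ y ∈ Γ.neighborSet x, T (t+1) y).Finite := by
      apply (hlf x).biUnion
      intro y hy
      have := hcon y (SimpleGraph.dist_eq_one_iff_adj.mpr hy).le
      simpa using this
    refine (hfin.union (Set.finite_singleton x)).subset ?_
    rintro v ⟨hvS, hv⟩
    by_cases hvx : v = x
    · right; exact hvx
    · left
      obtain ⟨w, hw⟩ := hconn.exists_walk_length_eq_dist x v
      cases w with
      | nil => exact absurd rfl hvx
      | @cons _ y _ hadj q =>
        simp only [SimpleGraph.Walk.length_cons] at hw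
        have h1 := SimpleGraph.dist_le q
        have h2 := hconn.dist_triangle (u := x) (v := y) (w := v)
        have h3 := SimpleGraph.dist_eq_one_iff_adj.mpr hadj
        simp only [Set.mem_iUnion]
        refine ⟨y, hadj, hvS, ?_⟩
        omega
  have h0 : (T 0 o).Infinite := by
    have : T 0 o = S := by ext v; simp [T]
    rwa [this]
  choose! nx hn1 hn2 using step
  let r : ℕ → V := fun n => Nat.rec o (fun t x => nx t x) n
  have hr : ∀ t, (T t (r t)).Infinite := by
    intro t
    induction t with
    | zero => exact h0
    | succ t ih => exact hn2 t _ ih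
  refine ⟨r, rfl, fun i => hn1 i _ (hr i), fun t => ?_⟩
  obtain ⟨v, hv⟩ := (hr t).nonempty
  exact ⟨v, hv.1, hv.2⟩

theorem ts_ray_geod {V : Type*} (Γ : SimpleGraph V) (hconn : Γ.Connected) (o : V) (S : Set V)
    (r : ℕ → V) (h0 : r 0 = o) (h1 : ∀ i, Γ.dist (r i) (r (i+1)) ≤ 1)
    (h2 : ∀ t, ∃ v ∈ S, Γ.dist o v = t + Γ.dist (r t) v) (i k : ℕ) :
    Γ.dist (r i) (r (i + k)) = k := by
  apply le_antisymm (ts_lip Γ hconn r h1 i k)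
  obtain ⟨v, -, hv⟩ := h2 (i+k)
  have e1 := hconn.dist_triangle (u := o) (v := r i) (w := v)
  have e2 := hconn.dist_triangle (u := r i) (v := r (i+k)) (w := v)
  have e3 := ts_lip Γ hconn r h1 0 i
  rw [h0, zero_add] at e3
  omega

theorem ts_qi {V Y : Type*} (Γ : SimpleGraph V) (hconn : Γ.Connected) (dY : Y → Y → ℝ)
    (g : Y → V) (C D : ℝ) (hC : 0 ≤ C) (hD : 0 ≤ D)
    (h1 : ∀ i j, (Γ.dist (g i) (g j) : ℝ) ≤ dY i j)
    (h2 : ∀ i j, dY i j ≤ 3 * (Γ.dist (g i) (g j) : ℝ) + C)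
    (h3 : ∀ v, ∃ i, (Γ.dist v (g i) : ℝ) ≤ D) :
    QuasiIsometric (fun x y : V => (Γ.dist x y : ℝ)) dY := by
  choose k hk using h3
  have tri : ∀ u v w : V, (Γ.dist u w : ℝ) ≤ Γ.dist u v + Γ.dist v w := by
    intro u v w; exact_mod_cast hconn.dist_triangle
  have comm : ∀ u v : V, (Γ.dist u v : ℝ) = Γ.dist v u := by
    intro u v; rw [Γ.dist_comm]
  refine ⟨k, 3, 6 * D + C, by norm_num, by positivity, ?_, ?_⟩
  · intro x x'
    have a1 := hk x
    have a2 := hk x'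
    have a3 := h1 (k x) (k x')
    have a4 := h2 (k x) (k x')
    have b1 := tri x (g (k x)) x'
    have b2 := tri (g (k x)) (g (k x')) x'
    have b3 := tri (g (k x)) x (g (k x'))
    have b4 := tri x x' (g (k x'))
    have c1 := comm x (g (k x))
    have c2 := comm x' (g (k x'))
    have : (0:ℝ) ≤ Γ.dist x x' := by positivity
    constructor
    · simp only; linarith
    · simp only; linarith
  · intro y
    refine ⟨g y, ?_⟩
    have a1 := hk (g y)
    have a2 := h2 (k (g y)) y
    have := comm (g y) (g (k (g y)))
    linarith

theorem ts_min {V Y : Type*} [Nonempty Y] (Γ : SimpleGraph V) (g : Y → V) (v : V) :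
    ∃ c, ∀ j, Γ.dist v (g c) ≤ Γ.dist v (g j) := by
  exact ⟨Function.argmin (fun j => Γ.dist v (g j)), fun j => Function.argmin_le (fun j => Γ.dist v (g j)) j⟩

/-- An infinite connected locally finite graph admitting a 2-selector is
quasi-isometric to `ℕ` or to `ℤ`. -/
theorem quasiIsometric_of_twoSelector {V : Type*} (Γ : SimpleGraph V)
    (hconn : Γ.Connected) (hlf : ∀ v : V, (Γ.neighborSet v).Finite)
    (hinf : Infinite V)
    (f : Finset V → V) (hf : GraphTwoSelector Γ f) :
    QuasiIsometric (fun x y : V => (Γ.dist x y : ℝ))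
        (fun a b : ℕ => |(a : ℝ) - (b : ℝ)|) ∨
      QuasiIsometric (fun x y : V => (Γ.dist x y : ℝ))
        (fun a b : ℤ => |(a : ℝ) - (b : ℝ)|) := by
  obtain ⟨hf1, hf2⟩ := hf
  obtain ⟨K, hf2⟩ := hf2 1
  obtain ⟨o⟩ := hconn.nonempty
  obtain ⟨r, r0, r1, r2⟩ := ts_ray Γ hconn hlf o Set.univ Set.infinite_univ
  have rg := ts_ray_geod Γ hconn o _ r r0 r1 r2
  have rd : ∀ i j : ℕ, (Γ.dist (r i) (r j) : ℤ) = |(i : ℤ) - j| := by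
    intro i j
    rcases le_total i j with h | h
    · have := rg i (j - i)
      rw [show i + (j - i) = j by omega] at this
      rw [this, abs_of_nonpos (by omega)]; omega
    · have := rg j (i - j)
      rw [show j + (i - j) = i by omega] at this
      rw [Γ.dist_comm, this, abs_of_nonneg (by omega)]; omega
  let S : Set V := {v | ∀ j, K < Γ.dist v (r j)}
  have hS : ∀ v ∈ S, ∀ j, Γ.dist v o ≤ Γ.dist v (r j) + 2 * K := by
    intro v hv j
    obtain ⟨c, hc⟩ := ts_min Γ r v
    by_cases hcK : c ≤ 2 * K
    · have e1 := hc j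
      have e2 := hconn.dist_triangle (u := v) (v := r c) (w := o)
      have e3 := rg 0 c
      rw [r0, zero_add, Γ.dist_comm] at e3
      omega
    · exfalso
      refine ts_tripod Γ hconn f K hf1 hf2 (fun i : ℤ => r i.toNat) ?_ v c (2 * K + 1) ?_ ?_ ?_ ?_
      · intro i
        rcases lt_or_ge i 0 with h | h
        · rw [show (i + 1).toNat = i.toNat by omega]; simp
        · rw [show (i + 1).toNat = i.toNat + 1 by omega]; exact r1 _
      · intro j; simpa using hc _
      · simpa using hv c
      · intro i hi
        have := rd ((c : ℤ) - (2 * K + 1 : ℕ)).toNat ((c : ℤ) + i).toNat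
        rw [abs_of_nonpos (by omega)] at this
        omega
      · intro i hi
        have := rd ((c : ℤ) + (2 * K + 1 : ℕ)).toNat ((c : ℤ) - i).toNat
        rw [abs_of_nonneg (by omega)] at this
        omega
  by_cases hfin : S.Finite
  · left
    obtain ⟨D, hD⟩ := (hfin.image (fun v => Γ.dist v o)).bddAbove
    refine ts_qi Γ hconn _ r 0 (K + D) le_rfl (by positivity) ?_ ?_ ?_
    · intro i j
      have := rd i j
      have h : (Γ.dist (r i) (r j) : ℝ) = |(i : ℝ) - j| := by exact_mod_cast this
      exact h.le
    · intro i j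
      have := rd i j
      have h : (Γ.dist (r i) (r j) : ℝ) = |(i : ℝ) - j| := by exact_mod_cast this
      have : (0:ℝ) ≤ Γ.dist (r i) (r j) := by positivity
      rw [← h]; linarith
    · intro v
      by_cases hv : v ∈ S
      · have : Γ.dist v o ≤ D := hD ⟨v, hv, rfl⟩
        refine ⟨0, ?_⟩
        rw [r0]
        exact_mod_cast (by omega : Γ.dist v o ≤ K + D)
      · simp only [S, Set.mem_setOf_eq, not_forall, not_lt] at hv
        obtain ⟨j, hj⟩ := hv
        exact ⟨j, by exact_mod_cast (by omega : Γ.dist v (r j) ≤ K + D)⟩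
  · right
    obtain ⟨s, s0, s1, s2⟩ := ts_ray Γ hconn hlf o S hfin
    have sg := ts_ray_geod Γ hconn o _ s s0 s1 s2
    have hsr : ∀ t j : ℕ, t + j ≤ 3 * Γ.dist (s t) (r j) + 4 * K := by
      intro t j
      obtain ⟨v, hv, e⟩ := s2 t
      have e1 := hS v hv j
      have e2 := hconn.dist_triangle (u := v) (v := s t) (w := r j)
      have e3 := hconn.dist_triangle (u := o) (v := s t) (w := r j)
      have e4 := sg 0 t
      have e5 := rg 0 j
      rw [s0, zero_add] at e4
      rw [r0, zero_add] at e5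
      have e6 := Γ.dist_comm (u := v) (v := s t)
      have e7 := Γ.dist_comm (u := v) (v := o)
      omega
    let g : ℤ → V := fun j => if 0 ≤ j then r j.toNat else s (-j).toNat
    have gpos : ∀ j : ℤ, 0 ≤ j → g j = r j.toNat := fun j h => if_pos h
    have gneg : ∀ j : ℤ, j ≤ 0 → g j = s (-j).toNat := by
      intro j h
      rcases h.eq_or_lt with rfl | h
      · rw [gpos 0 le_rfl]; simp [r0, s0]
      · exact if_neg (by omega)
    have hg : ∀ i, Γ.dist (g i) (g (i+1)) ≤ 1 := by
      intro i
      rcases lt_or_ge i 0 with h | h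
      · rw [gneg i (by omega), gneg (i+1) (by omega), Γ.dist_comm,
          show (-i).toNat = (-(i+1)).toNat + 1 by omega]
        exact s1 _
      · rw [gpos i h, gpos (i+1) (by omega), show (i + 1).toNat = i.toNat + 1 by omega]
        exact r1 _
    have hup := ts_lipZ Γ hconn g hg
    have hlow' : ∀ i j : ℤ, i ≤ j → j - i ≤ 3 * (Γ.dist (g i) (g j) : ℤ) + 4 * K := by
      intro i j hij
      rcases le_total 0 i with hi | hi
      · have := rg i.toNat (j - i).toNat
        rw [show i.toNat + (j - i).toNat = j.toNat by omega] at this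
        rw [gpos i hi, gpos j (by omega), this]; omega
      · rcases le_total j 0 with hj | hj
        · have := sg (-j).toNat (j - i).toNat
          rw [show (-j).toNat + (j - i).toNat = (-i).toNat by omega, Γ.dist_comm] at this
          rw [gneg i hi, gneg j hj, this]; omega
        · have := hsr (-i).toNat j.toNat
          rw [gneg i hi, gpos j hj]; omega
    have hlow : ∀ i j : ℤ, |i - j| ≤ 3 * (Γ.dist (g i) (g j) : ℤ) + 4 * K := by
      intro i j
      rcases le_total i j with h | h
      · rw [abs_of_nonpos (by omega)]; have := hlow' i j h; omega
      · rw [abs_of_nonneg (by omega), Γ.dist_comm]; have := hlow' j i h; omega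
    refine ts_qi Γ hconn _ g (4 * K) K (by positivity) (by positivity) ?_ ?_ ?_
    · intro i j; exact_mod_cast hup i j
    · intro i j; exact_mod_cast hlow i j
    · intro v
      obtain ⟨c, hc⟩ := ts_min Γ g v
      refine ⟨c, ?_⟩
      by_contra hcon
      have hcK : K < Γ.dist v (g c) := by
        by_contra h; exact hcon (by exact_mod_cast not_lt.mp h)
      refine ts_tripod Γ hconn f K hf1 hf2 g hg v c (10 * K + 3) hc hcK ?_ ?_
      · intro i hi
        have := hlow' (c - (10 * K + 3 : ℕ)) (c + i) (by omega)
        omega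
      · intro i hi
        have := hlow' (c - i) (c + (10 * K + 3 : ℕ)) (by omega)
        rw [Γ.dist_comm]
        omega
end

section
/- (Claim 2) Let Γ be a connected locally finite graph with vertex set V, f a 2-selector of Γ, and r ∈ ℕ such that d(f(A),f(B)) ≤ r whenever A,B are 2-element subsets of V with d_H(A,B) ≤ 1. Let v ∈ V, let B(v,r) = {x ∈ V : d(x,v) ≤ r}, and let U ⊆ V \ B(v,r) be such that the induced subgraph Γ[U] is connected. Then either v ≺ u for every u ∈ U, or u ≺ v for every u ∈ U. -/
/-- The relation `a ≺ b` associated with a 2-selector `f`. -/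
def Prec {V : Type*} [DecidableEq V] (f : Finset V → V) (a b : V) : Prop :=
  a ≠ b ∧ f {a, b} = a

/-- Claim 2: if `U` lies outside the ball `B(v, r)` and the induced subgraph `Γ[U]`
is connected, then either `v ≺ u` for every `u ∈ U`, or `u ≺ v` for every `u ∈ U`. -/
theorem claim2 {V : Type*} [DecidableEq V] (Γ : SimpleGraph V)
    (hconn : Γ.Connected) (hlf : ∀ v : V, (Γ.neighborSet v).Finite)
    (f : Finset V → V) (hf : GraphTwoSelector Γ f)
    (r : ℕ)
    (hr : ∀ A B : Finset V, A.card = 2 → B.card = 2 → HClose Γ A B 1 →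
      Γ.dist (f A) (f B) ≤ r)
    (v : V) (U : Set V)
    (hU : ∀ u ∈ U, r < Γ.dist u v)
    (hconnU : (Γ.induce U).Connected) :
    (∀ u ∈ U, Prec f v u) ∨ (∀ u ∈ U, Prec f u v) := by
  have hne : ∀ u ∈ U, v ≠ u := by
    rintro u hu rfl
    have := hU _ hu
    simp at this
  have hcard : ∀ u ∈ U, ({v, u} : Finset V).card = 2 := fun u hu =>
    Finset.card_pair (hne u hu)
  have hcase : ∀ u ∈ U, f {v, u} = v ∨ f {v, u} = u := fun u hu => by
    simpa using hf.1 _ (hcard u hu)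
  have step : ∀ u ∈ U, ∀ w ∈ U, Γ.Adj u w → f {v, u} = v → f {v, w} = v := by
    intro u hu w hw hadj h
    rcases hcase w hw with h' | h'
    · exact h'
    · exfalso
      have hd : Γ.dist u w ≤ 1 := (SimpleGraph.dist_eq_one_iff_adj.2 hadj).le
      have hc : HClose Γ {v, u} {v, w} 1 := by
        constructor
        · intro a ha
          simp only [Finset.mem_insert, Finset.mem_singleton] at ha
          rcases ha with rfl | rfl
          · exact ⟨a, by simp, by simp⟩
          · exact ⟨w, by simp, hd⟩
        · intro a ha
          simp only [Finset.mem_insert, Finset.mem_singleton] at ha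
          rcases ha with rfl | rfl
          · exact ⟨a, by simp, by simp⟩
          · exact ⟨u, by simp, hd⟩
      have h1 := hr _ _ (hcard u hu) (hcard w hw) hc
      rw [h, h', SimpleGraph.dist_comm] at h1
      exact absurd h1 (not_le.2 (hU w hw))
  have walk : ∀ a b : U, (Γ.induce U).Walk a b → f {v, a.1} = v → f {v, b.1} = v := by
    intro a b p
    induction p with
    | nil => exact id
    | @cons x y z hadj _ ih =>
      intro h
      exact ih (step x x.2 y y.2 (by simpa using hadj) h)
  by_cases hex : ∃ u ∈ U, f {v, u} = v
  · left
    obtain ⟨u, hu, h⟩ := hex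
    intro w hw
    obtain ⟨p⟩ := hconnU.preconnected ⟨u, hu⟩ ⟨w, hw⟩
    exact ⟨hne w hw, walk _ _ p h⟩
  · right
    intro w hw
    refine ⟨(hne w hw).symm, ?_⟩
    rw [Finset.pair_comm]
    exact (hcase w hw).resolve_left fun h => hex ⟨w, hw, h⟩
end

section
/- (Claim 3) Let Γ be a connected locally finite graph with vertex set V, f a 2-selector of Γ, and r ∈ ℕ such that d(f(A),f(B)) ≤ r whenever A,B are 2-element subsets of V with d_H(A,B) ≤ 1. Let u,v,v' ∈ V with d(v,v') = n and d(u,v) > n + r. If u ≺ v then u ≺ v', and if v ≺ u then v' ≺ u. -/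
theorem claim3_walk {V : Type*} [DecidableEq V] (Γ : SimpleGraph V)
    (hconn : Γ.Connected) (f : Finset V → V)
    (hf : ∀ A : Finset V, A.card = 2 → f A ∈ A) (r : ℕ)
    (hr : ∀ A B : Finset V, A.card = 2 → B.card = 2 → HClose Γ A B 1 →
      Γ.dist (f A) (f B) ≤ r)
    (u : V) {v w : V} (p : Γ.Walk v w) (h : p.length + r < Γ.dist u v) :
    (f {u, v} = u → f {u, w} = u) ∧ (f {u, v} = v → f {u, w} = w) := by
  induction p with
  | nil => exact ⟨id, id⟩
  | @cons v x w hadj p ih =>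
    rw [SimpleGraph.Walk.length_cons] at h
    have h1 : Γ.dist v x = 1 := SimpleGraph.dist_eq_one_iff_adj.mpr hadj
    have h1' : Γ.dist x v = 1 := by rw [SimpleGraph.dist_comm, h1]
    have h2 : Γ.dist u v ≤ Γ.dist u x + Γ.dist x v := hconn.dist_triangle
    have huv : u ≠ v := by
      rintro rfl
      simp at h
    have hux : u ≠ x := by
      rintro rfl
      rw [SimpleGraph.dist_self] at h2
      omega
    have key := hr {u, v} {u, x} (Finset.card_pair huv) (Finset.card_pair hux) (by
      constructor
      · intro a ha
        rcases Finset.mem_insert.mp ha with rfl | ha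
        · exact ⟨a, by simp, by simp⟩
        · rw [Finset.mem_singleton] at ha
          subst ha
          exact ⟨x, by simp, h1.le⟩
      · intro a ha
        rcases Finset.mem_insert.mp ha with rfl | ha
        · exact ⟨a, by simp, by simp⟩
        · rw [Finset.mem_singleton] at ha
          subst ha
          exact ⟨v, by simp, h1.le⟩)
    have hm : f {u, x} = u ∨ f {u, x} = x := by
      simpa using hf {u, x} (Finset.card_pair hux)
    obtain ⟨i1, i2⟩ := ih (by omega)
    constructor
    · intro e
      rcases hm with m | m
      · exact i1 m
      · rw [e, m] at key
        omega
    · intro e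
      rcases hm with m | m
      · rw [e, m, SimpleGraph.dist_comm] at key
        omega
      · exact i2 m

/-- Claim 3: if `d(v, v') = n` and `d(u, v) > n + r`, then `u ≺ v` implies `u ≺ v'`,
and `v ≺ u` implies `v' ≺ u`. -/
theorem claim3 {V : Type*} [DecidableEq V] (Γ : SimpleGraph V)
    (hconn : Γ.Connected) (hlf : ∀ v : V, (Γ.neighborSet v).Finite)
    (f : Finset V → V) (hf : GraphTwoSelector Γ f)
    (r : ℕ)
    (hr : ∀ A B : Finset V, A.card = 2 → B.card = 2 → HClose Γ A B 1 →
      Γ.dist (f A) (f B) ≤ r)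
    (u v v' : V) (n : ℕ)
    (hvv' : Γ.dist v v' = n) (huv : n + r < Γ.dist u v) :
    (Prec f u v → Prec f u v') ∧ (Prec f v u → Prec f v' u) := by
  obtain ⟨p, hp⟩ := hconn.exists_walk_length_eq_dist v v'
  obtain ⟨h1, h2⟩ := claim3_walk Γ hconn f hf.1 r hr u p (by omega)
  have hne : u ≠ v' := by
    rintro rfl
    rw [SimpleGraph.dist_comm] at hvv'
    omega
  refine ⟨fun h => ⟨hne, h1 h.2⟩, fun h => ⟨hne.symm, ?_⟩⟩
  rw [Finset.pair_comm]
  exact h2 (by rw [Finset.pair_comm]; exact h.2)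
end

section
/- (Claim 4) Let Γ be a connected locally finite graph with vertex set V, f a 2-selector of Γ, and r ∈ ℕ such that d(f(A),f(B)) ≤ r whenever A,B are 2-element subsets of V with d_H(A,B) ≤ 1. Let a_0,…,a_m be a geodesic path in Γ, v ∈ V, and k be such that d(v,{a_0,…,a_m}) = d(v,a_k), k > 2r+1 and m − k > 2r+1. Then d(v,a_k) ≤ r. -/
theorem aux_len {V : Type*} (Γ : SimpleGraph V) (hconn : Γ.Connected) (p : ℕ → V) (n : ℕ)
    (hs : ∀ i < n, Γ.dist (p i) (p (i + 1)) ≤ 1) (i j : ℕ) (hj : i + j ≤ n) :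
    Γ.dist (p i) (p (i + j)) ≤ j := by
  induction j with
  | zero => simp
  | succ j ih =>
    have h1 := ih (by omega)
    have h2 := hs (i + j) (by omega)
    have h3 := hconn.dist_triangle (u := p i) (v := p (i + j)) (w := p (i + j + 1))
    rw [← Nat.add_assoc]
    omega

theorem aux_step {V : Type*} [DecidableEq V] (Γ : SimpleGraph V)
    (f : Finset V → V) (hf : GraphTwoSelector Γ f) (r : ℕ)
    (hr : ∀ A B : Finset V, A.card = 2 → B.card = 2 → HClose Γ A B 1 →
      Γ.dist (f A) (f B) ≤ r) (x x' y : V) (h : Γ.dist x x' ≤ 1)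
    (h1 : r < Γ.dist x y) (h2 : r < Γ.dist x' y) :
    f {x, y} = x ↔ f {x', y} = x' := by
  have n1 : x ≠ y := by rintro rfl; simp at h1
  have n2 : x' ≠ y := by rintro rfl; simp at h2
  have c1 := Finset.card_pair n1
  have c2 := Finset.card_pair n2
  have m1 := hf.1 _ c1
  have m2 := hf.1 _ c2
  have hd := hr _ _ c1 c2 (by
    constructor
    · intro z hz
      simp only [Finset.mem_insert, Finset.mem_singleton] at hz
      rcases hz with rfl | rfl
      · exact ⟨x', by simp, h⟩
      · exact ⟨z, by simp, by simp⟩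
    · intro z hz
      simp only [Finset.mem_insert, Finset.mem_singleton] at hz
      rcases hz with rfl | rfl
      · exact ⟨x, by simp, h⟩
      · exact ⟨z, by simp, by simp⟩)
  simp only [Finset.mem_insert, Finset.mem_singleton] at m1 m2
  rcases m1 with m1 | m1 <;> rcases m2 with m2 | m2 <;> rw [m1, m2] at hd ⊢
  · simp
  · omega
  · rw [Γ.dist_comm] at hd; omega
  · simp [n1.symm, n2.symm]

theorem aux_path {V : Type*} [DecidableEq V] (Γ : SimpleGraph V)
    (f : Finset V → V) (hf : GraphTwoSelector Γ f) (r : ℕ)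
    (hr : ∀ A B : Finset V, A.card = 2 → B.card = 2 → HClose Γ A B 1 →
      Γ.dist (f A) (f B) ≤ r) (p : ℕ → V) (y : V) (i n : ℕ)
    (h : ∀ j < n, Γ.dist (p (i + j)) (p (i + j + 1)) ≤ 1)
    (h1 : ∀ j ≤ n, r < Γ.dist (p (i + j)) y) :
    f {p i, y} = p i ↔ f {p (i + n), y} = p (i + n) := by
  induction n with
  | zero => simp
  | succ n ih =>
    rw [ih (fun j hj => h j (by omega)) (fun j hj => h1 j (by omega))]
    exact aux_step Γ f hf r hr _ _ y (h n (by omega)) (h1 n (by omega)) (h1 (n + 1) le_rfl)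

theorem aux_swap {V : Type*} [DecidableEq V] (Γ : SimpleGraph V)
    (f : Finset V → V) (hf : GraphTwoSelector Γ f) (x y : V) (h : x ≠ y) :
    f {x, y} = x ↔ ¬ f {y, x} = y := by
  have m1 := hf.1 _ (Finset.card_pair h)
  rw [Finset.pair_comm y x]
  simp only [Finset.mem_insert, Finset.mem_singleton] at m1
  rcases m1 with m1 | m1 <;> rw [m1]
  · simp [h]
  · simp [h.symm]

/-- Claim 4: if `a_0, …, a_m` is a geodesic path, the distance from `v` to the path is
attained at `a_k`, and `k > 2r + 1`, `m - k > 2r + 1`, then `d(v, a_k) ≤ r`. -/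
theorem claim4 {V : Type*} [DecidableEq V] (Γ : SimpleGraph V)
    (hconn : Γ.Connected) (hlf : ∀ v : V, (Γ.neighborSet v).Finite)
    (f : Finset V → V) (hf : GraphTwoSelector Γ f)
    (r : ℕ)
    (hr : ∀ A B : Finset V, A.card = 2 → B.card = 2 → HClose Γ A B 1 →
      Γ.dist (f A) (f B) ≤ r)
    (m k : ℕ) (a : ℕ → V)
    (hgeo : Γ.dist (a 0) (a m) = m) (hstep : ∀ i < m, Γ.dist (a i) (a (i + 1)) = 1)
    (v : V) (hkm : k ≤ m)
    (hmin : ∀ i ≤ m, Γ.dist v (a k) ≤ Γ.dist v (a i))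
    (hk : 2 * r + 1 < k) (hmk : 2 * r + 1 < m - k) :
    Γ.dist v (a k) ≤ r := by
  by_contra hcon
  push Not at hcon
  have hs1 : ∀ i < m, Γ.dist (a i) (a (i + 1)) ≤ 1 := fun i hi => (hstep i hi).le
  have hd : ∀ i j, i + j ≤ m → Γ.dist (a i) (a (i + j)) = j := by
    intro i j hij
    have e1 := aux_len Γ hconn a m hs1 0 i (by omega)
    have e2 := aux_len Γ hconn a m hs1 i j hij
    have e3 := aux_len Γ hconn a m hs1 (i + j) (m - (i + j)) (by omega)
    rw [Nat.zero_add] at e1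
    rw [Nat.add_sub_cancel' hij] at e3
    have t1 := hconn.dist_triangle (u := a 0) (v := a i) (w := a m)
    have t2 := hconn.dist_triangle (u := a i) (v := a (i + j)) (w := a m)
    omega
  obtain ⟨h, hh⟩ : ∃ h, h = Γ.dist v (a k) := ⟨_, rfl⟩
  obtain ⟨b, hb0, hbh, hbs⟩ : ∃ b : ℕ → V, b 0 = a k ∧ b h = v ∧
      ∀ i < h, Γ.dist (b i) (b (i + 1)) ≤ 1 := by
    obtain ⟨w, hw⟩ := hconn.exists_walk_length_eq_dist (a k) v
    rw [Γ.dist_comm, ← hh] at hw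
    refine ⟨w.getVert, by simp, by rw [← hw]; simp, fun i hi => ?_⟩
    exact (SimpleGraph.dist_eq_one_iff_adj.mpr (w.adj_getVert_succ (by omega))).le
  have hbd : ∀ s ≤ h, ∀ i ≤ m, 2 * r + 2 ≤ Γ.dist (a k) (a i) → r < Γ.dist (b s) (a i) := by
    intro s hs i hi hki
    have e1 := aux_len Γ hconn b h hbs 0 s (by omega)
    have e2 := aux_len Γ hconn b h hbs s (h - s) (by omega)
    rw [Nat.zero_add, hb0] at e1
    rw [Nat.add_sub_cancel' hs, hbh, Γ.dist_comm] at e2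
    have t1 := hconn.dist_triangle (u := a k) (v := b s) (w := a i)
    have t2 := hconn.dist_triangle (u := v) (v := b s) (w := a i)
    have := hmin i hi
    omega
  obtain ⟨l, rfl⟩ : ∃ l, k = l + (2 * r + 2) := ⟨k - (2 * r + 2), by omega⟩
  set k := l + (2 * r + 2) with hkdef
  have hm2 : k + (2 * r + 2) ≤ m := by omega
  have hL : 2 * r + 2 ≤ Γ.dist (a k) (a l) := by
    rw [Γ.dist_comm, hd l (2 * r + 2) (by omega)]
  have hR : 2 * r + 2 ≤ Γ.dist (a k) (a (k + (2 * r + 2))) := by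
    rw [hd k (2 * r + 2) (by omega)]
  have key : ∀ i j, i ≤ m → j ≤ m → i + r < j → r < Γ.dist (a i) (a j) := by
    intro i j hi hj hij
    obtain ⟨t, rfl⟩ : ∃ t, j = i + t := ⟨j - i, by omega⟩
    rw [hd i t hj]; omega
  have s1 := aux_path Γ f hf r hr a (a (k + (2 * r + 2))) l (2 * r + 2)
    (fun j hj => hs1 _ (by omega)) (fun j hj => key _ _ (by omega) (by omega) (by omega))
  have s2 := aux_path Γ f hf r hr b (a (k + (2 * r + 2))) 0 h
    (fun j hj => hbs _ (by omega)) (fun j hj => hbd _ (by omega) _ (by omega) hR)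
  have s3 := aux_path Γ f hf r hr a v l (2 * r + 2 + (2 * r + 2))
    (fun j hj => hs1 _ (by omega)) (fun j hj => by
      rw [Γ.dist_comm]; exact lt_of_lt_of_le hcon (hmin _ (by omega)))
  have s4 := aux_path Γ f hf r hr b (a l) 0 h
    (fun j hj => hbs _ (by omega)) (fun j hj => hbd _ (by omega) _ (by omega) hL)
  have s5 := aux_path Γ f hf r hr a (a l) k (2 * r + 2)
    (fun j hj => hs1 _ (by omega))
    (fun j hj => by rw [Γ.dist_comm]; exact key _ _ (by omega) (by omega) (by omega))
  rw [Nat.zero_add, hb0, hbh] at s2 s4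
  rw [← Nat.add_assoc] at s3
  rw [← hkdef] at s1 s3
  have ne : ∀ i ≤ m, v ≠ a i := by
    intro i hi he
    have := hmin i hi
    rw [← he, SimpleGraph.dist_self] at this
    omega
  have w1 := aux_swap Γ f hf v (a (k + (2 * r + 2))) (ne _ (by omega))
  have w2 := aux_swap Γ f hf v (a l) (ne _ (by omega))
  have w3 := aux_swap Γ f hf (a l) (a (k + (2 * r + 2))) (by
    intro he
    have := key l (k + (2 * r + 2)) (by omega) (by omega) (by omega)
    rw [← he] at this
    simp at this)
  rw [s1, s2, w1, ← s3, ← s5, s4, w2] at w3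
  exact iff_not_self w3
end

section
/- The spider graph T consisting of three rays with a common initial vertex (vertex set {o} ∪ ({0,1,2} × {1,2,3,…}), where o is adjacent to (i,1) for each i, and (i,n) is adjacent to (i,n+1) for all i,n) does not admit a 2-selector. -/
/-- Vertices of the spider: the center `none`, together with three rays of vertices
`some (i, n)` for `i : Fin 3` and `n : ℕ+`. -/
abbrev SpiderVertex : Type := Option (Fin 3 × ℕ+)

/-- The spider graph: three rays with a common initial vertex. The center is adjacent
to `(i, 1)` for each `i`, and `(i, n)` is adjacent to `(i, n + 1)` for all `i, n`. -/
def spider : SimpleGraph SpiderVertex :=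
  SimpleGraph.fromRel (fun x y =>
    match x, y with
    | none, some (_, n) => n = 1
    | some (i, n), some (j, m) => i = j ∧ m = n + 1
    | _, _ => False)

def spP (i : Fin 3) : ℕ → SpiderVertex
  | 0 => none
  | n + 1 => some (i, n.succPNat)

def spH (i : Fin 3) : SpiderVertex → ℕ
  | none => 0
  | some (j, n) => if j = i then (n : ℕ) else 0

lemma spP_adj (i : Fin 3) (n : ℕ) : spider.Adj (spP i n) (spP i (n+1)) := by
  unfold spider
  rw [SimpleGraph.fromRel_adj]
  cases n with
  | zero => exact ⟨by simp [spP], Or.inl rfl⟩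
  | succ n =>
    refine ⟨?_, Or.inl ⟨rfl, rfl⟩⟩
    intro h
    simp [spP] at h

lemma spP_reach (i : Fin 3) (n : ℕ) : spider.Reachable none (spP i n) := by
  induction n with
  | zero => exact SimpleGraph.Reachable.refl _
  | succ n ih => exact ih.trans (spP_adj i n).reachable

lemma spH_adj (i : Fin 3) (x y : SpiderVertex) (h : spider.Adj x y) :
    spH i x ≤ spH i y + 1 := by
  unfold spider at h
  rw [SimpleGraph.fromRel_adj] at h
  obtain ⟨-, h⟩ := h
  rcases x with _ | ⟨j, n⟩ <;> rcases y with _ | ⟨k, l⟩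
  · simp [spH]
  · simp [spH]
  · have hn : n = 1 := by simpa using h
    subst hn
    simp only [spH]
    split_ifs <;> simp
  · simp only at h
    rcases h with ⟨rfl, rfl⟩ | ⟨rfl, rfl⟩ <;> simp only [spH] <;> split_ifs <;>
      (try simp only [PNat.add_coe, PNat.one_coe]) <;> omega

lemma spH_walk (i : Fin 3) (x y : SpiderVertex) (w : spider.Walk x y) :
    spH i x ≤ spH i y + w.length := by
  induction w with
  | nil => simp
  | cons h w ih =>
    have := spH_adj i _ _ h
    rw [SimpleGraph.Walk.length_cons]
    omega

lemma spH_P_self (i : Fin 3) (n : ℕ) : spH i (spP i n) = n := by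
  cases n <;> simp [spP, spH]

lemma spH_P_ne (i j : Fin 3) (h : i ≠ j) (n : ℕ) : spH i (spP j n) = 0 := by
  cases n <;> simp [spP, spH, h.symm]

lemma sp_dist (i j : Fin 3) (h : i ≠ j) (N n : ℕ) :
    N ≤ spider.dist (spP i N) (spP j n) := by
  obtain ⟨w, hw⟩ := ((spP_reach i N).symm.trans (spP_reach j n)).exists_walk_length_eq_dist
  have := spH_walk i _ _ w
  rw [spH_P_self, spH_P_ne i j h] at this
  omega

/-- The spider graph (three rays with a common initial vertex) admits no 2-selector. -/
theorem spider_no_twoSelector : ¬ ∃ f : Finset SpiderVertex → SpiderVertex,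
    GraphTwoSelector spider f := by
  rintro ⟨f, hf, hu⟩
  obtain ⟨m, hm⟩ := hu 1
  have step : ∀ a b b' : SpiderVertex, m < spider.dist a b → m < spider.dist a b' →
      spider.Adj b b' → f {a, b} = a → f {a, b'} = a := by
    intro a b b' h1 h2 hadj hfa
    have hab : a ≠ b := by rintro rfl; simp at h1
    have hab' : a ≠ b' := by rintro rfl; simp at h2
    have c1 := Finset.card_pair hab
    have c2 := Finset.card_pair hab'
    have hd : spider.dist b b' ≤ 1 := (SimpleGraph.dist_eq_one_iff_adj.2 hadj).le
    have hcl : HClose spider {a, b} {a, b'} 1 := by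
      constructor
      · intro x hx
        rcases Finset.mem_insert.1 hx with rfl | hx
        · exact ⟨x, by simp, by simp⟩
        · rw [Finset.mem_singleton.1 hx]; exact ⟨b', by simp, hd⟩
      · intro x hx
        rcases Finset.mem_insert.1 hx with rfl | hx
        · exact ⟨x, by simp, by simp⟩
        · rw [Finset.mem_singleton.1 hx]; exact ⟨b, by simp, hd⟩
    have := hm _ _ c1 c2 hcl
    rw [hfa] at this
    rcases Finset.mem_insert.1 (hf _ c2) with h | h
    · exact h
    · rw [Finset.mem_singleton.1 h] at this; omega
  have move : ∀ i j : Fin 3, i ≠ j → ∀ n : ℕ,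
      (f {spP i (m+1), spP j n} = spP i (m+1) ↔ f {spP i (m+1), none} = spP i (m+1)) := by
    intro i j hij n
    induction n with
    | zero => exact Iff.rfl
    | succ n ih =>
      rw [← ih]
      have d1 := sp_dist i j hij (m+1) n
      have d2 := sp_dist i j hij (m+1) (n+1)
      exact ⟨step _ _ _ (by omega) (by omega) (spP_adj j n).symm,
        step _ _ _ (by omega) (by omega) (spP_adj j n)⟩
  have swap : ∀ i j : Fin 3, i ≠ j →
      (f {spP i (m+1), none} = spP i (m+1) ↔ ¬ f {spP j (m+1), none} = spP j (m+1)) := by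
    intro i j hij
    rw [← move i j hij (m+1), ← move j i hij.symm (m+1), Finset.pair_comm (spP j (m+1))]
    have hne : spP i (m+1) ≠ spP j (m+1) := by
      intro h
      have := sp_dist i j hij (m+1) (m+1)
      rw [h] at this
      simp at this
    have := hf _ (Finset.card_pair hne)
    rw [Finset.mem_insert, Finset.mem_singleton] at this
    constructor
    · intro h h'
      exact hne (h.symm.trans h')
    · intro h
      exact this.resolve_right h
  have h1 := swap 0 1 (by decide)
  have h2 := swap 0 2 (by decide)
  have h3 := swap 1 2 (by decide)
  tauto
end
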